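/- arXiv:math/0605009 — 9 statements merged into one kernel-verified Lean document; each statement's English description precedes it below -/
import Mathlib

section
/- Let c : ℝ → ℝ² be a smooth 2π-periodic immersion and h : ℝ → ℝ² a smooth 2π-periodic map. Then the function t ↦ ℓ(c + t h) is differentiable at t = 0 and its derivative equals ∫₀^{2π} ⟨h'(θ), c'(θ)⟩/|c'(θ)| dθ, which moreover equals −∫ κ_c ⟨h, n⟩ ds. -/
open Real MeasureTheory

/-- Euclidean inner product on ℝ² ≅ ℂ. -/
noncomputable def dot (x y : ℂ) : ℝ := x.re * y.re + x.im * y.im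

/-- Curvature κ_c = ⟨Jc', c''⟩ / |c'|³ of a plane curve, with J = rotation by 90°
(multiplication by `Complex.I`). -/
noncomputable def curvature (c : ℝ → ℂ) (θ : ℝ) : ℝ :=
  dot (Complex.I * deriv c θ) (deriv (deriv c) θ) / ‖deriv c θ‖ ^ 3

/-- Unit normal n = J v = J c'/|c'|. -/
noncomputable def unitNormal (c : ℝ → ℂ) (θ : ℝ) : ℂ :=
  Complex.I * (‖deriv c θ‖⁻¹ • deriv c θ)

lemma hasDerivAt_re' {f : ℝ → ℂ} {f' : ℂ} {x : ℝ} (hf : HasDerivAt f f' x) :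
    HasDerivAt (fun t => (f t).re) f'.re x :=
  Complex.reCLM.hasFDerivAt.comp_hasDerivAt x hf

lemma hasDerivAt_im' {f : ℝ → ℂ} {f' : ℂ} {x : ℝ} (hf : HasDerivAt f f' x) :
    HasDerivAt (fun t => (f t).im) f'.im x :=
  Complex.imCLM.hasFDerivAt.comp_hasDerivAt x hf

lemma norm_sq_eq' (z : ℂ) : ‖z‖ ^ 2 = z.re * z.re + z.im * z.im := by
  rw [Complex.sq_norm, Complex.normSq_apply]

lemma norm_eq_sqrt' (z : ℂ) : ‖z‖ = √(z.re * z.re + z.im * z.im) := by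
  rw [← norm_sq_eq', Real.sqrt_sq (norm_nonneg z)]

lemma hasDerivAt_norm' {f : ℝ → ℂ} {f' : ℂ} {x : ℝ} (hf : HasDerivAt f f' x) (h0 : f x ≠ 0) :
    HasDerivAt (fun t => ‖f t‖) (dot f' (f x) / ‖f x‖) x := by
  have hpos : 0 < ‖f x‖ := norm_pos_iff.mpr h0
  have hr := hasDerivAt_re' hf
  have hi := hasDerivAt_im' hf
  have hs := ((hr.mul hr).add (hi.mul hi)).sqrt (by
    have := norm_sq_eq' (f x)
    have h2 : ‖f x‖ ^ 2 ≠ 0 := by positivity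
    rw [this] at h2
    exact h2)
  have e : (fun t => ‖f t‖) = fun t => √((f t).re * (f t).re + (f t).im * (f t).im) := by
    funext t; exact norm_eq_sqrt' _
  rw [e]
  refine HasDerivAt.congr_deriv hs ?_
  change _ / (2 * √((f x).re * (f x).re + (f x).im * (f x).im)) = _
  rw [← norm_eq_sqrt', dot]
  field_simp
  ring

lemma hasDerivAt_dot' {f g : ℝ → ℂ} {f' g' : ℂ} {x : ℝ} (hf : HasDerivAt f f' x)
    (hg : HasDerivAt g g' x) :
    HasDerivAt (fun t => dot (f t) (g t)) (dot f' (g x) + dot (f x) g') x := by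
  have := ((hasDerivAt_re' hf).mul (hasDerivAt_re' hg)).add
    ((hasDerivAt_im' hf).mul (hasDerivAt_im' hg))
  refine HasDerivAt.congr_deriv this ?_
  simp only [dot]
  ring

lemma continuous_dot' {f g : ℝ → ℂ} (hf : Continuous f) (hg : Continuous g) :
    Continuous (fun t => dot (f t) (g t)) := by
  unfold dot
  fun_prop

/-- for a smooth 2π-periodic immersion `c` and smooth 2π-periodic `h`,
the length function t ↦ ℓ(c + t h) is differentiable at 0 with derivative
∫₀^{2π} ⟨h', c'⟩/|c'| dθ, and this value equals −∫ κ_c ⟨h, n⟩ ds. -/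
theorem stmt0 (c h : ℝ → ℂ)
    (hc : ContDiff ℝ (⊤ : ℕ∞) c) (hcper : ∀ θ, c (θ + 2 * π) = c θ)
    (hcimm : ∀ θ, deriv c θ ≠ 0)
    (hh : ContDiff ℝ (⊤ : ℕ∞) h) (hhper : ∀ θ, h (θ + 2 * π) = h θ) :
    HasDerivAt (fun t : ℝ => ∫ θ in (0:ℝ)..2 * π, ‖deriv (fun x => c x + t • h x) θ‖)
        (∫ θ in (0:ℝ)..2 * π, dot (deriv h θ) (deriv c θ) / ‖deriv c θ‖) 0 ∧
      (∫ θ in (0:ℝ)..2 * π, dot (deriv h θ) (deriv c θ) / ‖deriv c θ‖) =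
        -∫ θ in (0:ℝ)..2 * π, curvature c θ * dot (h θ) (unitNormal c θ) * ‖deriv c θ‖ := by
  have hcd : Differentiable ℝ c := hc.differentiable (by simp)
  have hhd : Differentiable ℝ h := hh.differentiable (by simp)
  have hc' : ContDiff ℝ (⊤ : ℕ∞) (deriv c) := (contDiff_infty_iff_deriv.mp hc).2
  have hcd' : Differentiable ℝ (deriv c) := hc'.differentiable (by simp)
  have kc : Continuous (deriv c) := hc'.continuous
  have kc2 : Continuous (deriv (deriv c)) := (contDiff_infty_iff_deriv.mp hc').2.continuous
  have kh' : Continuous (deriv h) := (contDiff_infty_iff_deriv.mp hh).2.continuous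
  have kh : Continuous h := hh.continuous
  have hne : ∀ θ, ‖deriv c θ‖ ≠ 0 := fun θ => norm_ne_zero_iff.mpr (hcimm θ)
  have kI : Continuous (fun θ => dot (deriv h θ) (deriv c θ) / ‖deriv c θ‖) :=
    (continuous_dot' kh' kc).div kc.norm hne
  constructor
  · have e : (fun t : ℝ => ∫ θ in (0:ℝ)..2 * π, ‖deriv (fun x => c x + t • h x) θ‖) =
        fun t : ℝ => ∫ θ in (0:ℝ)..2 * π, ‖deriv c θ + t • deriv h θ‖ := by
      funext t
      congr 1
      funext θ
      exact congrArg norm ((hcd θ).hasDerivAt.add ((hhd θ).hasDerivAt.const_smul t)).deriv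
    rw [e]
    refine (intervalIntegral.hasDerivAt_integral_of_dominated_loc_of_lip
      (F := fun t θ => ‖deriv c θ + t • deriv h θ‖) (bound := fun θ => ‖deriv h θ‖)
      (s := Set.univ) Filter.univ_mem ?_ ?_ ?_ ?_ ?_ ?_).2
    · exact Filter.Eventually.of_forall fun t =>
        (kc.add (kh'.const_smul t)).norm.aestronglyMeasurable
    · exact (kc.add (kh'.const_smul (0:ℝ))).norm.intervalIntegrable _ _
    · exact kI.aestronglyMeasurable
    · refine Filter.Eventually.of_forall fun θ _ => ?_
      refine LipschitzOnWith.of_dist_le_mul fun s _ t _ => ?_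
      rw [Real.dist_eq, Real.dist_eq]
      refine (abs_norm_sub_norm_le _ _).trans (le_of_eq ?_)
      rw [add_sub_add_left_eq_sub, ← sub_smul, norm_smul, Real.norm_eq_abs]
      simp [mul_comm]
    · exact kh'.norm.intervalIntegrable _ _
    · refine Filter.Eventually.of_forall fun θ _ => ?_
      have h1 : HasDerivAt (fun t : ℝ => deriv c θ + t • deriv h θ) (deriv h θ) 0 := by
        simpa using ((hasDerivAt_id (0:ℝ)).smul_const (deriv h θ)).const_add (deriv c θ)
      simpa using hasDerivAt_norm' h1 (by simpa using hcimm θ)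
  · have kK : Continuous
        (fun θ => curvature c θ * dot (h θ) (unitNormal c θ) * ‖deriv c θ‖) := by
      unfold curvature unitNormal
      refine (Continuous.mul (Continuous.div (continuous_dot' (by fun_prop) kc2) (by fun_prop)
        (fun θ => pow_ne_zero _ (hne θ))) (continuous_dot' kh ?_)).mul kc.norm
      exact continuous_const.mul ((kc.norm.inv₀ hne).smul kc)
    have hF : ∀ θ, HasDerivAt (fun θ => dot (h θ) (deriv c θ) / ‖deriv c θ‖)
        (dot (deriv h θ) (deriv c θ) / ‖deriv c θ‖ +
          curvature c θ * dot (h θ) (unitNormal c θ) * ‖deriv c θ‖) θ := by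
      intro θ
      have h1 := (hasDerivAt_dot' (hhd θ).hasDerivAt (hcd' θ).hasDerivAt).div
        (hasDerivAt_norm' (hcd' θ).hasDerivAt (hcimm θ)) (hne θ)
      refine HasDerivAt.congr_deriv h1 ?_
      have hr := hne θ
      have hsq := norm_sq_eq' (deriv c θ)
      unfold curvature unitNormal
      generalize ‖deriv c θ‖ = r at *
      simp only [dot, Complex.mul_re, Complex.mul_im, Complex.I_re, Complex.I_im,
        Complex.smul_re, Complex.smul_im, smul_eq_mul]
      generalize deriv (deriv c) θ = w at *
      generalize deriv c θ = z at *
      generalize deriv h θ = k at *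
      generalize h θ = u at *
      field_simp
      linear_combination (u.re * w.re + u.im * w.im) * hsq
    have hint := intervalIntegral.integral_eq_sub_of_hasDerivAt (a := 0) (b := 2 * π)
      (fun θ _ => hF θ) ((kI.add kK).intervalIntegrable _ _)
    rw [intervalIntegral.integral_add (kI.intervalIntegrable _ _) (kK.intervalIntegrable _ _)]
      at hint
    have hper' : deriv c (2 * π) = deriv c 0 := by
      have : (fun θ => c (θ + 2 * π)) = c := funext hcper
      have h2 := deriv_comp_add_const c (2 * π) 0
      rw [this] at h2
      simpa using h2.symm
    have hp : h (2 * π) = h 0 := by simpa using hhper 0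
    rw [hper', hp] at hint
    linarith
end

section
/- Let c : ℝ × ℝ → ℂ be a smooth family of closed curves (2π-periodic in θ, with ∂_θ c(t,θ) ≠ 0 everywhere), and let Z : ℝ × ℝ → ℂ be a smooth map with Z(t,θ)² = ∂_θ c(t,θ) for all (t,θ). Then for every t, ∫₀^{2π} |∂_t Z(t,θ)|² dθ = (1/4) ∫₀^{2π} |∂_t ∂_θ c(t,θ)|² / |∂_θ c(t,θ)| dθ; that is, in the square-root coordinate Z = √(c_θ) of Trouvé–Younes, the metric ∫ |D_s(c_t)|² ds becomes four times the flat L² metric ∫ |Z_t|² dθ. -/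
open Real MeasureTheory

/-- in the Trouvé–Younes square-root coordinate Z = √(c_θ), the metric
∫ |D_s(c_t)|² ds becomes four times the flat L² metric ∫ |Z_t|² dθ: for every t,
∫₀^{2π} |∂_t Z|² dθ = (1/4) ∫₀^{2π} |∂_t ∂_θ c|²/|∂_θ c| dθ. -/
theorem stmt3 (c Z : ℝ → ℝ → ℂ)
    (hc : ContDiff ℝ (⊤ : ℕ∞) (fun p : ℝ × ℝ => c p.1 p.2))
    (hcper : ∀ t θ, c t (θ + 2 * π) = c t θ)
    (hcimm : ∀ t θ, deriv (c t) θ ≠ 0)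
    (hZ : ContDiff ℝ (⊤ : ℕ∞) (fun p : ℝ × ℝ => Z p.1 p.2))
    (hZsq : ∀ t θ, Z t θ ^ 2 = deriv (c t) θ) :
    ∀ t, ∫ θ in (0:ℝ)..2 * π, ‖deriv (fun s => Z s θ) t‖ ^ 2
      = (1 / 4) * ∫ θ in (0:ℝ)..2 * π,
          ‖deriv (fun s => deriv (c s) θ) t‖ ^ 2 / ‖deriv (c t) θ‖ := by
  intro t
  rw [← intervalIntegral.integral_const_mul]
  congr 1
  funext θ
  have hne : Z t θ ≠ 0 := by
    intro h
    apply hcimm t θ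
    rw [← hZsq, h]
    simp
  have hn : ‖Z t θ‖ ≠ 0 := norm_ne_zero_iff.mpr hne
  have hd : DifferentiableAt ℝ (fun s => Z s θ) t := by
    have h1 : ContDiff ℝ (⊤ : ℕ∞) (fun s : ℝ => Z s θ) :=
      hZ.comp (contDiff_id.prodMk contDiff_const : ContDiff ℝ (⊤ : ℕ∞) (fun s : ℝ => (s, θ)))
    exact (h1.differentiable (by simp)) t
  have h2 : deriv (fun s => deriv (c s) θ) t = 2 * Z t θ * deriv (fun s => Z s θ) t := by
    have h3 : (fun s => deriv (c s) θ) = fun s => Z s θ * Z s θ := by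
      funext s
      rw [← hZsq, sq]
    rw [h3]
    refine (hd.hasDerivAt.mul hd.hasDerivAt).deriv.trans ?_
    ring
  rw [h2, ← hZsq, norm_pow, norm_mul, norm_mul, Complex.norm_ofNat]
  field_simp
  norm_num
end

section
/- Let c : ℝ → ℝ² be a smooth 2π-periodic immersion, A > 0, n ≥ 1 an integer, and define L_{n,c}(h) = h + (−1)ⁿ A D_s^{2n} h for smooth 2π-periodic h : ℝ → ℝ², and L^⊤_c(f) = ⟨L_{n,c}(f v), v⟩ for smooth 2π-periodic scalar f. Then L^⊤_c is symmetric and positive for the arclength pairing: for all smooth 2π-periodic f, g : ℝ → ℝ, ∫ L^⊤_c(f) g ds = ∫ f L^⊤_c(g) ds, and ∫ L^⊤_c(f) f ds > 0 whenever f is not identically zero. -/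
open Real MeasureTheory

/-- Unit tangent v = c'/|c'|. -/
noncomputable def unitTangent (c : ℝ → ℂ) (θ : ℝ) : ℂ := ‖deriv c θ‖⁻¹ • deriv c θ

/-- Arclength derivative D_s f = f'/|c'| for ℂ-valued f, iterated for D_s^{2n}. -/
noncomputable def Ds (c : ℝ → ℂ) (f : ℝ → ℂ) : ℝ → ℂ := fun θ => ‖deriv c θ‖⁻¹ • deriv f θ

/-- The operator L_{n,c}(h) = h + (−1)ⁿ A D_s^{2n} h. -/
noncomputable def Lop (A : ℝ) (n : ℕ) (c : ℝ → ℂ) (h : ℝ → ℂ) : ℝ → ℂ :=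
  fun θ => h θ + ((-1 : ℝ) ^ n * A) • (Ds c)^[2 * n] h θ

/-- L^⊤_c(f) = ⟨L_{n,c}(f v), v⟩. -/
noncomputable def Ltop (A : ℝ) (n : ℕ) (c : ℝ → ℂ) (f : ℝ → ℝ) : ℝ → ℝ :=
  fun θ => dot (Lop A n c (fun x => f x • unitTangent c x) θ) (unitTangent c θ)

theorem dot_eq_inner (x y : ℂ) : dot x y = inner ℝ x y := by
  simp [dot, Complex.inner]; ring

/-- smooth and periodic -/
def SP {E : Type} [NormedAddCommGroup E] [NormedSpace ℝ E] (h : ℝ → E) : Prop :=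
  ContDiff ℝ (⊤ : ℕ∞) h ∧ ∀ θ, h (θ + 2 * π) = h θ

theorem SP.dd {E : Type} [NormedAddCommGroup E] [NormedSpace ℝ E] {h : ℝ → E} (hh : SP h) :
    SP (deriv h) := by
  refine ⟨(contDiff_infty_iff_deriv.1 hh.1).2, fun θ => ?_⟩
  rw [← deriv_comp_add_const]
  congr 1
  funext x
  exact hh.2 x

theorem SP.norm' {c : ℝ → ℂ} (hc : SP c) (hi : ∀ θ, deriv c θ ≠ 0) :
    SP (fun θ => ‖deriv c θ‖) :=
  ⟨hc.dd.1.norm ℝ hi, fun θ => by simp only [hc.dd.2 θ]⟩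

theorem SP.inv' {c : ℝ → ℂ} (hc : SP c) (hi : ∀ θ, deriv c θ ≠ 0) :
    SP (fun θ => ‖deriv c θ‖⁻¹) :=
  ⟨(hc.norm' hi).1.inv (fun x => norm_ne_zero_iff.2 (hi x)), fun θ => by simp only [hc.dd.2 θ]⟩

theorem SP.smul' {r : ℝ → ℝ} {h : ℝ → ℂ} (hr : SP r) (hh : SP h) : SP (fun θ => r θ • h θ) :=
  ⟨hr.1.smul hh.1, fun θ => by simp only [hr.2 θ, hh.2 θ]⟩

theorem SP.ds {c h : ℝ → ℂ} (hc : SP c) (hi : ∀ θ, deriv c θ ≠ 0) (hh : SP h) : SP (Ds c h) :=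
  (hc.inv' hi).smul' hh.dd

theorem SP.dsIter {c : ℝ → ℂ} (hc : SP c) (hi : ∀ θ, deriv c θ ≠ 0) (m : ℕ) :
    ∀ {h : ℝ → ℂ}, SP h → SP ((Ds c)^[m] h) := by
  induction m with
  | zero => exact fun h => h
  | succ m ih => exact fun h => ih (hc.ds hi h)

/-- arclength pairing -/
noncomputable def pair (c h k : ℝ → ℂ) : ℝ :=
  ∫ θ in (0:ℝ)..2 * π, dot (h θ) (k θ) * ‖deriv c θ‖

theorem dot_cont {h k : ℝ → ℂ} (hh : SP h) (hk : SP k) : Continuous fun θ => dot (h θ) (k θ) := by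
  simp only [dot_eq_inner]
  exact hh.1.continuous.inner hk.1.continuous

theorem pair_comm (c h k : ℝ → ℂ) : pair c h k = pair c k h := by
  unfold pair dot
  congr 1; funext θ; ring

theorem pair_ds {c h k : ℝ → ℂ} (hc : SP c) (hi : ∀ θ, deriv c θ ≠ 0) (hh : SP h) (hk : SP k) :
    pair c (Ds c h) k = - pair c h (Ds c k) := by
  have hd : ∀ θ, HasDerivAt (fun θ => (inner ℝ (h θ) (k θ) : ℝ))
      (inner ℝ (h θ) (deriv k θ) + inner ℝ (deriv h θ) (k θ)) θ := fun θ =>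
    ((hh.1.differentiable (by simp)) θ).hasDerivAt.inner ℝ
      ((hk.1.differentiable (by simp)) θ).hasDerivAt
  have c1 : Continuous fun θ => (inner ℝ (h θ) (deriv k θ) : ℝ) :=
    hh.1.continuous.inner hk.dd.1.continuous
  have c2 : Continuous fun θ => (inner ℝ (deriv h θ) (k θ) : ℝ) :=
    hh.dd.1.continuous.inner hk.1.continuous
  have key := intervalIntegral.integral_eq_sub_of_hasDerivAt (a := 0) (b := 2 * π)
    (fun θ _ => hd θ) ((c1.add c2).intervalIntegrable _ _)
  have e1 := hh.2 0
  have e2 := hk.2 0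
  rw [zero_add] at e1 e2
  rw [e1, e2, sub_self, intervalIntegral.integral_add (c1.intervalIntegrable _ _)
    (c2.intervalIntegrable _ _)] at key
  have p1 : pair c (Ds c h) k = ∫ θ in (0:ℝ)..2 * π, (inner ℝ (deriv h θ) (k θ) : ℝ) := by
    unfold pair
    congr 1; funext θ
    have := norm_ne_zero_iff.2 (hi θ)
    rw [dot_eq_inner, Ds, real_inner_smul_left]
    field_simp
  have p2 : pair c h (Ds c k) = ∫ θ in (0:ℝ)..2 * π, (inner ℝ (h θ) (deriv k θ) : ℝ) := by
    unfold pair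
    congr 1; funext θ
    have := norm_ne_zero_iff.2 (hi θ)
    rw [dot_eq_inner, Ds, real_inner_smul_right]
    field_simp
  rw [p1, p2]; linarith

theorem pair_iter {c : ℝ → ℂ} (hc : SP c) (hi : ∀ θ, deriv c θ ≠ 0) (m : ℕ) :
    ∀ {h k : ℝ → ℂ}, SP h → SP k →
    pair c ((Ds c)^[m] h) k = (-1) ^ m * pair c h ((Ds c)^[m] k) := by
  induction m with
  | zero => intro h k _ _; simp
  | succ m ih =>
    intro h k hh hk
    rw [Function.iterate_succ_apply, ih (hc.ds hi hh) hk, pair_ds hc hi hh (hc.dsIter hi m hk),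
      Function.iterate_succ_apply', pow_succ]
    ring

theorem SP.tangent {c : ℝ → ℂ} (hc : SP c) (hi : ∀ θ, deriv c θ ≠ 0) : SP (unitTangent c) :=
  (hc.inv' hi).smul' hc.dd

theorem key_formula {A : ℝ} {n : ℕ} {c : ℝ → ℂ} (hc : SP c) (hi : ∀ θ, deriv c θ ≠ 0)
    {f g : ℝ → ℝ} (hf : SP f) (hg : SP g) :
    ∫ θ in (0:ℝ)..2 * π, Ltop A n c f θ * g θ * ‖deriv c θ‖ =
      pair c (fun x => f x • unitTangent c x) (fun x => g x • unitTangent c x) +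
      A * pair c ((Ds c)^[n] (fun x => f x • unitTangent c x))
        ((Ds c)^[n] (fun x => g x • unitTangent c x)) := by
  have hF := hf.smul' (hc.tangent hi)
  have hG := hg.smul' (hc.tangent hi)
  have hn := (hc.norm' hi).1.continuous
  have h1 := pair_iter hc hi n (hc.dsIter hi n hF) hG
  rw [← Function.iterate_add_apply, ← two_mul] at h1
  have h2 : ((-1 : ℝ) ^ n) * (-1) ^ n = 1 := by rw [← mul_pow]; simp
  have h3 : ∫ θ in (0:ℝ)..2 * π, Ltop A n c f θ * g θ * ‖deriv c θ‖ =
      pair c (fun x => f x • unitTangent c x) (fun x => g x • unitTangent c x) +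
      ((-1) ^ n * A) * pair c ((Ds c)^[2 * n] (fun x => f x • unitTangent c x))
        (fun x => g x • unitTangent c x) := by
    unfold pair
    rw [← intervalIntegral.integral_const_mul, ← intervalIntegral.integral_add]
    rotate_left
    · exact ((dot_cont hF hG).mul hn).intervalIntegrable _ _
    · exact (((dot_cont (hc.dsIter hi (2 * n) hF) hG).mul hn).const_mul _).intervalIntegrable _ _
    congr 1; funext θ
    simp only [Ltop, Lop, dot_eq_inner, inner_add_left, real_inner_smul_left,
      real_inner_smul_right]
    ring
  rw [h3, h1]
  linear_combination (A * pair c ((Ds c)^[n] (fun x => f x • unitTangent c x))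
        ((Ds c)^[n] (fun x => g x • unitTangent c x))) * h2

theorem pair_self_nonneg (c h : ℝ → ℂ) : 0 ≤ pair c h h :=
  intervalIntegral.integral_nonneg (by positivity) fun θ _ => by
    rw [dot_eq_inner]; exact mul_nonneg real_inner_self_nonneg (norm_nonneg _)

theorem pair_self_pos {c h : ℝ → ℂ} (hc : SP c) (hi : ∀ θ, deriv c θ ≠ 0) (hh : SP h)
    (hne : ∃ θ, h θ ≠ 0) : 0 < pair c h h := by
  obtain ⟨t, ht⟩ := hne
  have hp : Function.Periodic h (2 * π) := hh.2
  obtain ⟨y, hy, hty⟩ := hp.exists_mem_Ico₀ (by positivity) t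
  refine intervalIntegral.integral_pos (by positivity)
    ((dot_cont hh hh).mul (hc.norm' hi).1.continuous).continuousOn (fun θ _ => ?_)
    ⟨y, Set.Ico_subset_Icc_self hy, ?_⟩
  · rw [dot_eq_inner]; exact mul_nonneg real_inner_self_nonneg (norm_nonneg _)
  · rw [dot_eq_inner]
    exact mul_pos (real_inner_self_pos.2 (hty ▸ ht)) (norm_pos_iff.2 (hi y))

/-- L^⊤_c is symmetric and positive for the arclength pairing. -/
theorem stmt5 (A : ℝ) (hA : 0 < A) (n : ℕ) (hn : 1 ≤ n) (c : ℝ → ℂ)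
    (hc : ContDiff ℝ (⊤ : ℕ∞) c) (hcper : ∀ θ, c (θ + 2 * π) = c θ)
    (hcimm : ∀ θ, deriv c θ ≠ 0) :
    (∀ f g : ℝ → ℝ, ContDiff ℝ (⊤ : ℕ∞) f → (∀ θ, f (θ + 2 * π) = f θ) →
        ContDiff ℝ (⊤ : ℕ∞) g → (∀ θ, g (θ + 2 * π) = g θ) →
      ∫ θ in (0:ℝ)..2 * π, Ltop A n c f θ * g θ * ‖deriv c θ‖
        = ∫ θ in (0:ℝ)..2 * π, f θ * Ltop A n c g θ * ‖deriv c θ‖) ∧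
    (∀ f : ℝ → ℝ, ContDiff ℝ (⊤ : ℕ∞) f → (∀ θ, f (θ + 2 * π) = f θ) → (∃ θ, f θ ≠ 0) →
      0 < ∫ θ in (0:ℝ)..2 * π, Ltop A n c f θ * f θ * ‖deriv c θ‖) := by
  have hC : SP c := ⟨hc, hcper⟩
  constructor
  · intro f g hf hfp hg hgp
    have hF : SP f := ⟨hf, hfp⟩
    have hG : SP g := ⟨hg, hgp⟩
    have e : ∀ θ, f θ * Ltop A n c g θ * ‖deriv c θ‖ = Ltop A n c g θ * f θ * ‖deriv c θ‖ :=
      fun θ => by ring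
    simp only [e]
    rw [key_formula hC hcimm hF hG, key_formula hC hcimm hG hF, pair_comm, pair_comm c ((Ds c)^[n] _)]
  · rintro f hf hfp ⟨t, ht⟩
    have hF : SP f := ⟨hf, hfp⟩
    rw [key_formula hC hcimm hF hF]
    refine add_pos_of_pos_of_nonneg (pair_self_pos hC hcimm (hF.smul' (hC.tangent hcimm)) ⟨t, ?_⟩)
      (mul_nonneg hA.le (pair_self_nonneg _ _))
    exact smul_ne_zero ht (smul_ne_zero (inv_ne_zero (norm_ne_zero_iff.2 (hcimm t))) (hcimm t))
end

section
/- Let c : ℝ × ℝ → ℝ² be a smooth family of closed curves (2π-periodic in θ, with ∂_θ c(t,θ) ≠ 0 everywhere). Then there exists a smooth map φ : ℝ × ℝ → ℝ with φ(t, θ + 2π) = φ(t,θ) + 2π, φ(0, θ) = θ, and ∂_θ φ(t,θ) > 0 for all (t,θ), such that the reparametrized family e(t,θ) = c(t, φ(t,θ)) is horizontal: ⟨∂_t e(t,θ), ∂_θ e(t,θ)⟩ = 0 for all (t,θ). -/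
open Real MeasureTheory

lemma contDiff_of_partials {u a b : ℝ → ℝ → ℝ} {n : ℕ}
    (ha : ContDiff ℝ n (fun p : ℝ × ℝ => a p.1 p.2))
    (hb : ContDiff ℝ n (fun p : ℝ × ℝ => b p.1 p.2))
    (h1 : ∀ t x, HasDerivAt (fun s => u s x) (a t x) t)
    (h2 : ∀ t x, HasDerivAt (u t) (b t x) x) :
    ContDiff ℝ ((n + 1 : ℕ)) (fun p : ℝ × ℝ => u p.1 p.2) := by
  push_cast
  rw [contDiff_succ_iff_hasFDerivAt]
  refine ⟨fun p => a p.1 p.2 • ContinuousLinearMap.fst ℝ ℝ ℝ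
    + b p.1 p.2 • ContinuousLinearMap.snd ℝ ℝ ℝ, ?_, ?_⟩
  · exact (ha.smul contDiff_const).add (hb.smul contDiff_const)
  · intro p
    have key := hasStrictFDerivAt_uncurry_coprod (𝕜 := ℝ) (u := p) (f := u)
      (f₁ := fun t x => (ContinuousLinearMap.toSpanSingleton ℝ (a t x)))
      (f₂ := fun t x => (ContinuousLinearMap.toSpanSingleton ℝ (b t x)))
      (Filter.Eventually.of_forall fun v => (h1 v.1 v.2).hasFDerivAt)
      (Filter.Eventually.of_forall fun v => (h2 v.1 v.2).hasFDerivAt)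
      (((ContinuousLinearMap.toSpanSingletonLE ℝ ℝ ℝ).toLinearMap.continuous_of_finiteDimensional.comp ha.continuous).continuousAt)
      (((ContinuousLinearMap.toSpanSingletonLE ℝ ℝ ℝ).toLinearMap.continuous_of_finiteDimensional.comp hb.continuous).continuousAt)
    refine key.hasFDerivAt.congr_fderiv ?_
    ext <;> simp [Function.HasUncurry.uncurry]

section partials
variable {E : Type*} [NormedAddCommGroup E] [NormedSpace ℝ E]

lemma hasDerivAt_snd {u : ℝ → ℝ → E} (hu : ContDiff ℝ 1 (fun p : ℝ × ℝ => u p.1 p.2)) (t x : ℝ) :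
    HasDerivAt (u t) (fderiv ℝ (fun p : ℝ × ℝ => u p.1 p.2) (t, x) (0, 1)) x := by
  have h := ((hu.differentiable (by simp)) (t, x)).hasFDerivAt
  have h2 : HasDerivAt (fun y : ℝ => (t, y)) ((0 : ℝ), (1 : ℝ)) x :=
    (hasDerivAt_const x t).prodMk (hasDerivAt_id x)
  exact h.comp_hasDerivAt x h2

lemma hasDerivAt_fst {u : ℝ → ℝ → E} (hu : ContDiff ℝ 1 (fun p : ℝ × ℝ => u p.1 p.2)) (t x : ℝ) :
    HasDerivAt (fun s => u s x) (fderiv ℝ (fun p : ℝ × ℝ => u p.1 p.2) (t, x) (1, 0)) t := by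
  have h := ((hu.differentiable (by simp)) (t, x)).hasFDerivAt
  have h2 : HasDerivAt (fun y : ℝ => (y, x)) ((1 : ℝ), (0 : ℝ)) t :=
    (hasDerivAt_id t).prodMk (hasDerivAt_const t x)
  exact h.comp_hasDerivAt t h2

lemma contDiff_dsnd {u : ℝ → ℝ → E} {n : WithTop ℕ∞}
    (hu : ContDiff ℝ (n + 1) (fun p : ℝ × ℝ => u p.1 p.2)) :
    ContDiff ℝ n (fun p : ℝ × ℝ => deriv (u p.1) p.2) := by
  have h1 : ContDiff ℝ 1 (fun p : ℝ × ℝ => u p.1 p.2) := hu.of_le (by simp)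
  have : (fun p : ℝ × ℝ => deriv (u p.1) p.2)
      = fun p => fderiv ℝ (fun p : ℝ × ℝ => u p.1 p.2) p (0, 1) := by
    ext p; exact (hasDerivAt_snd h1 p.1 p.2).deriv
  rw [this]
  exact (hu.fderiv_right le_rfl).clm_apply contDiff_const

lemma contDiff_dfst {u : ℝ → ℝ → E} {n : WithTop ℕ∞}
    (hu : ContDiff ℝ (n + 1) (fun p : ℝ × ℝ => u p.1 p.2)) :
    ContDiff ℝ n (fun p : ℝ × ℝ => deriv (fun s => u s p.2) p.1) := by
  have h1 : ContDiff ℝ 1 (fun p : ℝ × ℝ => u p.1 p.2) := hu.of_le (by simp)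
  have : (fun p : ℝ × ℝ => deriv (fun s => u s p.2) p.1)
      = fun p => fderiv ℝ (fun p : ℝ × ℝ => u p.1 p.2) p (1, 0) := by
    ext p; exact (hasDerivAt_fst h1 p.1 p.2).deriv
  rw [this]
  exact (hu.fderiv_right le_rfl).clm_apply contDiff_const

end partials

lemma contDiff_primitive (n : ℕ) : ∀ {g : ℝ → ℝ → ℝ},
    ContDiff ℝ n (fun p : ℝ × ℝ => g p.1 p.2) →
    ContDiff ℝ n (fun p : ℝ × ℝ => ∫ s in (0 : ℝ)..p.1, g s p.2) := by
  induction n with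
  | zero =>
    intro g hg
    have hg' : Continuous (fun p : ℝ × ℝ => g p.1 p.2) := hg.continuous
    simp only [Nat.cast_zero, contDiff_zero]
    refine intervalIntegral.continuous_parametric_intervalIntegral_of_continuous
      (f := fun (p : ℝ × ℝ) s => g s p.2) ?_ continuous_fst
    exact hg'.comp (continuous_snd.prodMk (continuous_snd.comp continuous_fst))
  | succ n ih =>
    intro g hg
    have hgc : Continuous (fun p : ℝ × ℝ => g p.1 p.2) := hg.continuous
    have hg1 : ContDiff ℝ 1 (fun p : ℝ × ℝ => g p.1 p.2) := hg.of_le (by simp)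
    have hd : ContDiff ℝ n (fun p : ℝ × ℝ => deriv (g p.1) p.2) := contDiff_dsnd (by simpa using hg)
    have hdc : Continuous (fun p : ℝ × ℝ => deriv (g p.1) p.2) := hd.continuous
    refine contDiff_of_partials (u := fun t x => ∫ s in (0 : ℝ)..t, g s x) (a := g)
      (b := fun t x => ∫ s in (0 : ℝ)..t, deriv (g s) x) (hg.of_le (by simp)) (ih hd) ?_ ?_
    · intro t x
      have : Continuous (fun s => g s x) := hgc.comp (continuous_id.prodMk continuous_const)
      exact intervalIntegral.integral_hasDerivAt_right (this.intervalIntegrable _ _)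
        (this.stronglyMeasurableAtFilter _ _) this.continuousAt
    · intro t x
      obtain ⟨M, hM⟩ := (isCompact_uIcc (a := (0:ℝ)) (b := t)).prod (isCompact_Icc (a := x - 1) (b := x + 1))
        |>.exists_bound_of_continuousOn hdc.continuousOn
      have c1 : ∀ x, Continuous (fun s => g s x) :=
        fun x => hgc.comp (continuous_id.prodMk continuous_const)
      have c2 : Continuous (fun s => deriv (g s) x) := hdc.comp (continuous_id.prodMk continuous_const)
      refine (intervalIntegral.hasDerivAt_integral_of_dominated_loc_of_deriv_le
        (F := fun x s => g s x) (F' := fun x s => deriv (g s) x) (s := Set.Icc (x - 1) (x + 1))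
        (bound := fun _ => M)
        (Icc_mem_nhds (by linarith) (by linarith)) (Filter.Eventually.of_forall fun y => (c1 y).aestronglyMeasurable)
        ((c1 x).intervalIntegrable _ _) c2.aestronglyMeasurable ?_ (by simp) ?_).2
      · refine Filter.Eventually.of_forall fun s hs y hy => hM (s, y) ⟨Set.uIoc_subset_uIcc hs, hy⟩
      · refine Filter.Eventually.of_forall fun s hs y hy => ?_
        exact (hasDerivAt_snd hg1 s y).differentiableAt.hasDerivAt

lemma periodic_bound {g : ℝ → ℝ → ℝ} (hg : Continuous (fun p : ℝ × ℝ => g p.1 p.2))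
    (hp : ∀ t x, g t (x + 2 * π) = g t x) (T : ℝ) :
    ∃ M : NNReal, ∀ t ∈ Set.Icc (-T) T, ∀ x, ‖g t x‖ ≤ M := by
  obtain ⟨M, hM⟩ := (isCompact_Icc (a := -T) (b := T)).prod (isCompact_Icc (a := 0) (b := 2 * π))
        |>.exists_bound_of_continuousOn hg.continuousOn
  refine ⟨M.toNNReal, fun t ht x => ?_⟩
  obtain ⟨y, hy, h⟩ := Function.Periodic.exists_mem_Ico₀ (f := g t) (hp t) (by positivity) x
  rw [h]
  exact (hM (t, y) ⟨ht, Set.Ico_subset_Icc_self hy⟩).trans (Real.le_coe_toNNReal M)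

lemma deriv_periodic {g : ℝ → ℝ → ℝ}
    (hp : ∀ t x, g t (x + 2 * π) = g t x) (t x : ℝ) : deriv (g t) (x + 2 * π) = deriv (g t) x := by
  rw [← deriv_comp_add_const]
  congr 1
  ext y
  exact hp t y

lemma global_solution {f : ℝ → ℝ → ℝ} (hf : ContDiff ℝ (⊤ : ℕ∞) (fun p : ℝ × ℝ => f p.1 p.2))
    (hp : ∀ t x, f t (x + 2 * π) = f t x) (x₀ : ℝ) :
    ∃ α : ℝ → ℝ, α 0 = x₀ ∧ ∀ t, HasDerivAt α (f t (α t)) t := by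
  have hf1 : ContDiff ℝ 1 (fun p : ℝ × ℝ => f p.1 p.2) := hf.of_le (by simp)
  have hfc : Continuous (fun p : ℝ × ℝ => f p.1 p.2) := hf.continuous
  have hdc : Continuous (fun p : ℝ × ℝ => deriv (f p.1) p.2) :=
    (contDiff_dsnd (n := 0) (by simpa using hf1)).continuous
  have lip : ∀ T : ℝ, ∃ K : NNReal, ∀ t ∈ Set.Icc (-T) T, LipschitzWith K (f t) := by
    intro T
    obtain ⟨K, hK⟩ := periodic_bound hdc (deriv_periodic hp) T
    refine ⟨K, fun t ht => lipschitzWith_of_nnnorm_deriv_le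
      (fun x => (hasDerivAt_snd hf1 t x).differentiableAt) (fun x => hK t ht x)⟩
  have ex : ∀ T : ℝ, 0 < T → ∃ α : ℝ → ℝ, α 0 = x₀ ∧
      ∀ t ∈ Set.Ioo (-T) T, HasDerivAt α (f t (α t)) t := by
    intro T hT
    obtain ⟨K, hK⟩ := lip T
    obtain ⟨L, hL⟩ := periodic_bound hfc hp T
    have hPL : IsPicardLindelof f (tmin := -T) (tmax := T) ⟨0, by simp [hT.le]⟩ x₀
        (L * T.toNNReal) 0 L K := by
      refine ⟨fun t ht => (hK t ht).lipschitzOnWith, fun x _ => ?_, fun t ht x _ => hL t ht x, ?_⟩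
      · exact (hfc.comp (continuous_id.prodMk continuous_const)).continuousOn
      · simp [hT.le]
    obtain ⟨α, h0, h⟩ := hPL.exists_eq_forall_mem_Icc_hasDerivWithinAt₀
    exact ⟨α, h0, fun t ht => (h t (Set.Ioo_subset_Icc_self ht)).hasDerivAt (Icc_mem_nhds ht.1 ht.2)⟩
  choose! A hA0 hA using ex
  have agree : ∀ T S : ℝ, 0 < T → T ≤ S → ∀ t ∈ Set.Ioo (-T) T, A T t = A S t := by
    intro T S hT hTS
    obtain ⟨K, hK⟩ := lip T
    refine ODE_solution_unique_of_mem_Ioo (K := K) (v := f) (s := fun _ => Set.univ) (t₀ := 0)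
      (fun t ht => (hK t (Set.Ioo_subset_Icc_self ht)).lipschitzOnWith) (by simp [hT])
      (fun t ht => ⟨hA T hT t ht, trivial⟩) (fun t ht => ⟨hA S (hT.trans_le hTS) t
        ⟨by linarith [ht.1], by linarith [ht.2]⟩, trivial⟩) ?_
    rw [hA0 T hT, hA0 S (hT.trans_le hTS)]
  refine ⟨fun t => A (|t| + 1) t, by simpa using hA0 1 one_pos, fun t => ?_⟩
  have hmem : ∀ s : ℝ, s ∈ Set.Ioo (-(|s| + 1)) (|s| + 1) := fun s =>
    ⟨by linarith [neg_abs_le s], by linarith [le_abs_self s]⟩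
  have hpos : ∀ s : ℝ, 0 < |s| + 1 := fun s => by positivity
  have h := hA (|t| + 2) (by positivity) t ⟨by linarith [neg_abs_le t], by linarith [le_abs_self t]⟩
  have e : ∀ s : ℝ, |s| ≤ |t| + 1 → A (|s| + 1) s = A (|t| + 2) s := fun s hs =>
    agree _ _ (hpos s) (by linarith) s (hmem s)
  rw [← e t (by linarith)] at h
  refine h.congr_of_eventuallyEq ?_
  have : ∀ᶠ s in nhds t, |s| < |t| + 1 := continuous_abs.continuousAt.eventually_lt_const (by linarith)
  filter_upwards [this] with s hs
  exact e s hs.le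

/-- averaged derivative -/
noncomputable def avg (f : ℝ → ℝ → ℝ) (t x y : ℝ) : ℝ :=
  ∫ u in (0 : ℝ)..1, deriv (f t) (x + u * (y - x))

lemma avg_mul {f : ℝ → ℝ → ℝ} (hf1 : ContDiff ℝ 1 (fun p : ℝ × ℝ => f p.1 p.2)) (t x y : ℝ) :
    f t y - f t x = avg f t x y * (y - x) := by
  have hdc : Continuous (fun p : ℝ × ℝ => deriv (f p.1) p.2) :=
    (contDiff_dsnd (n := 0) (by simpa using hf1)).continuous
  have hc : Continuous (fun u : ℝ => deriv (f t) (x + u * (y - x)) * (y - x)) :=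
    (hdc.comp (g := fun p : ℝ × ℝ => deriv (f p.1) p.2) (f := fun u : ℝ => (t, x + u * (y - x)))
      (by fun_prop)).mul continuous_const
  have := intervalIntegral.integral_eq_sub_of_hasDerivAt (a := 0) (b := 1)
    (f := fun u => f t (x + u * (y - x)))
    (f' := fun u => deriv (f t) (x + u * (y - x)) * (y - x)) (fun u _ => ?_)
    (hc.intervalIntegrable _ _)
  · rw [intervalIntegral.integral_mul_const] at this
    rw [avg, this]; simp
  · have h1 := (hasDerivAt_snd hf1 t (x + u * (y - x))).differentiableAt.hasDerivAt
    have h2 : HasDerivAt (fun u : ℝ => x + u * (y - x)) (y - x) u := by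
      simpa using ((hasDerivAt_id u).mul_const (y - x)).const_add x
    exact h1.comp u h2

lemma avg_continuous {f : ℝ → ℝ → ℝ} (hf1 : ContDiff ℝ 1 (fun p : ℝ × ℝ => f p.1 p.2)) :
    Continuous (fun p : ℝ × ℝ × ℝ => avg f p.1 p.2.1 p.2.2) := by
  have hdc : Continuous (fun p : ℝ × ℝ => deriv (f p.1) p.2) :=
    (contDiff_dsnd (n := 0) (by simpa using hf1)).continuous
  refine intervalIntegral.continuous_parametric_intervalIntegral_of_continuous'
    (f := fun (p : ℝ × ℝ × ℝ) u => deriv (f p.1) (p.2.1 + u * (p.2.2 - p.2.1))) ?_ 0 1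
  exact hdc.comp (g := fun p : ℝ × ℝ => deriv (f p.1) p.2)
    (f := fun q : (ℝ × ℝ × ℝ) × ℝ => (q.1.1, q.1.2.1 + q.2 * (q.1.2.2 - q.1.2.1))) (by fun_prop)

lemma avg_self (f : ℝ → ℝ → ℝ) (t x : ℝ) : avg f t x x = deriv (f t) x := by simp [avg]

lemma solution_diff {f : ℝ → ℝ → ℝ} (hf1 : ContDiff ℝ 1 (fun p : ℝ × ℝ => f p.1 p.2))
    {α β : ℝ → ℝ} (hα : ∀ t, HasDerivAt α (f t (α t)) t) (hβ : ∀ t, HasDerivAt β (f t (β t)) t)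
    (t : ℝ) : β t - α t = (β 0 - α 0) * exp (∫ s in (0 : ℝ)..t, avg f s (α s) (β s)) := by
  have hac : Continuous α := continuous_iff_continuousAt.2 fun t => (hα t).continuousAt
  have hbc : Continuous β := continuous_iff_continuousAt.2 fun t => (hβ t).continuousAt
  have hF : Continuous (fun s => avg f s (α s) (β s)) :=
    (avg_continuous hf1).comp (f := fun s => (s, α s, β s)) (by fun_prop)
  have hI : ∀ t, HasDerivAt (fun t => ∫ s in (0 : ℝ)..t, avg f s (α s) (β s)) (avg f t (α t) (β t)) t :=
    fun t => intervalIntegral.integral_hasDerivAt_right (hF.intervalIntegrable _ _)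
        (hF.stronglyMeasurableAtFilter _ _) hF.continuousAt
  have hD : ∀ t, HasDerivAt (fun t => (β t - α t) * exp (-∫ s in (0 : ℝ)..t, avg f s (α s) (β s))) 0 t := by
    intro t
    refine (((hβ t).sub (hα t)).mul (hI t).neg.exp).congr_deriv ?_
    rw [avg_mul hf1]; simp only [Pi.sub_apply]; ring
  have hconst := is_const_of_deriv_eq_zero (fun t => (hD t).differentiableAt) (fun t => (hD t).deriv) t 0
  simp only [intervalIntegral.integral_same, neg_zero, exp_zero, mul_one] at hconst
  rw [← hconst, mul_assoc, ← exp_add]; simp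

theorem exists_flow {f : ℝ → ℝ → ℝ} (hf : ContDiff ℝ (⊤ : ℕ∞) (fun p : ℝ × ℝ => f p.1 p.2))
    (hp : ∀ t x, f t (x + 2 * π) = f t x) :
    ∃ φ : ℝ → ℝ → ℝ, ContDiff ℝ (⊤ : ℕ∞) (fun p : ℝ × ℝ => φ p.1 p.2) ∧
      (∀ t θ, φ t (θ + 2 * π) = φ t θ + 2 * π) ∧
      (∀ θ, φ 0 θ = θ) ∧
      (∀ t θ, 0 < deriv (φ t) θ) ∧
      (∀ t θ, HasDerivAt (fun s => φ s θ) (f t (φ t θ)) t) := by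
  have hf1 : ContDiff ℝ 1 (fun p : ℝ × ℝ => f p.1 p.2) := hf.of_le (by simp)
  have hd : ContDiff ℝ (⊤ : ℕ∞) (fun p : ℝ × ℝ => deriv (f p.1) p.2) :=
    contDiff_dsnd (by simpa using hf)
  have hdc := hd.continuous
  choose ψ hψ0 hψ using global_solution hf hp
  have hcont_t : ∀ x, Continuous (ψ x) := fun x =>
    continuous_iff_continuousAt.2 fun t => (hψ x t).continuousAt
  -- joint continuity
  have hcont : Continuous (fun p : ℝ × ℝ => ψ p.2 p.1) := by
    have hloc : ∀ T : ℝ, 0 < T →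
        ContinuousOn (fun p : ℝ × ℝ => ψ p.2 p.1) (Set.Ioo (-T) T ×ˢ Set.univ) := by
      intro T hT
      obtain ⟨M, hM⟩ := periodic_bound hdc (deriv_periodic hp) T
      refine continuousOn_prod_of_continuousOn_lipschitzOnWith' _ (exp (M * T)).toNNReal
        (fun t ht => ?_) (fun x _ => (hcont_t x).continuousOn)
      rw [lipschitzOnWith_univ]
      refine LipschitzWith.of_dist_le_mul fun x y => ?_
      rw [Real.coe_toNNReal _ (exp_pos _).le, dist_comm, dist_comm x y, Real.dist_eq, Real.dist_eq,
        solution_diff hf1 (hψ x) (hψ y), hψ0, hψ0, abs_mul, abs_of_pos (exp_pos _), mul_comm]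
      refine mul_le_mul_of_nonneg_right (exp_le_exp.2 ?_) (abs_nonneg _)
      have hsub : ∀ s ∈ Set.uIoc 0 t, s ∈ Set.Icc (-T) T := by
        intro s hs
        rcases Set.mem_uIoc.1 hs with h | h
        · exact ⟨by linarith [h.1], by linarith [h.2, ht.2]⟩
        · exact ⟨by linarith [h.1, ht.1], by linarith [h.2]⟩
      have hb : ∀ s ∈ Set.uIoc 0 t, ‖avg f s (ψ x s) (ψ y s)‖ ≤ M := by
        intro s hs
        have := intervalIntegral.norm_integral_le_of_norm_le_const (a := 0) (b := 1) (C := M)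
          (f := fun u => deriv (f s) (ψ x s + u * (ψ y s - ψ x s))) (fun u _ => hM s (hsub s hs) _)
        simpa [avg] using this
      have h3 := intervalIntegral.norm_integral_le_of_norm_le_const hb
      refine (le_abs_self _).trans (h3.trans ?_)
      refine mul_le_mul_of_nonneg_left ?_ M.2
      rw [sub_zero]
      exact abs_le.2 ⟨ht.1.le, ht.2.le⟩
    rw [continuous_iff_continuousAt]
    intro p
    refine (hloc (|p.1| + 1) (by positivity)).continuousAt ?_
    refine (isOpen_Ioo.prod isOpen_univ).mem_nhds ⟨⟨?_, ?_⟩, trivial⟩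
    · linarith [neg_abs_le p.1]
    · linarith [le_abs_self p.1]
  -- derivative in x
  have hdx : ∀ t x, HasDerivAt (fun x => ψ x t)
      (exp (∫ s in (0 : ℝ)..t, deriv (f s) (ψ x s))) x := by
    intro t x
    rw [hasDerivAt_iff_tendsto_slope]
    have hG : Continuous (fun y => exp (∫ s in (0 : ℝ)..t, avg f s (ψ x s) (ψ y s))) := by
      refine continuous_exp.comp ?_
      refine intervalIntegral.continuous_parametric_intervalIntegral_of_continuous'
        (f := fun y s => avg f s (ψ x s) (ψ y s)) ?_ 0 t
      refine (avg_continuous hf1).comp (f := fun q : ℝ × ℝ => (q.2, ψ x q.2, ψ q.1 q.2)) ?_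
      exact continuous_snd.prodMk (((hcont_t x).comp continuous_snd).prodMk
        (hcont.comp continuous_swap))
    have h := (hG.tendsto x).mono_left (nhdsWithin_le_nhds (s := {x}ᶜ))
    simp only [avg_self] at h
    refine h.congr' ?_
    filter_upwards [self_mem_nhdsWithin] with y hy
    have hne : y - x ≠ 0 := sub_ne_zero.2 hy
    rw [slope_def_field, solution_diff hf1 (hψ x) (hψ y), hψ0, hψ0]
    field_simp
  have hsm : ∀ n : ℕ, ContDiff ℝ n (fun p : ℝ × ℝ => ψ p.2 p.1) := by
    intro n
    induction n with
    | zero => simpa using hcont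
    | succ n ih =>
      refine contDiff_of_partials (u := fun t x => ψ x t) (a := fun t x => f t (ψ x t))
        (b := fun t x => exp (∫ s in (0 : ℝ)..t, deriv (f s) (ψ x s))) ?_ ?_
        (fun t x => hψ x t) hdx
      · exact (contDiff_infty.1 hf n).comp (contDiff_fst.prodMk ih)
      · refine ContDiff.exp ?_
        refine contDiff_primitive n (g := fun s x => deriv (f s) (ψ x s)) ?_
        exact (contDiff_infty.1 hd n).comp (contDiff_fst.prodMk ih)
  refine ⟨fun t x => ψ x t, contDiff_infty.2 hsm, fun t θ => ?_, hψ0, fun t θ => ?_,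
    fun t θ => hψ θ t⟩
  · have h2 : ∀ t, HasDerivAt (fun t => ψ θ t + 2 * π) (f t (ψ θ t + 2 * π)) t := fun t => by
      rw [hp]; exact (hψ θ t).add_const _
    have := solution_diff hf1 h2 (hψ (θ + 2 * π)) t
    rw [hψ0, hψ0, sub_self, zero_mul] at this
    exact sub_eq_zero.1 this
  · rw [(hdx t θ).deriv]; exact exp_pos _

lemma dot_contDiff {g h : ℝ × ℝ → ℂ} (hg : ContDiff ℝ (⊤ : ℕ∞) g) (hh : ContDiff ℝ (⊤ : ℕ∞) h) :
    ContDiff ℝ (⊤ : ℕ∞) (fun p => dot (g p) (h p)) :=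
  ((Complex.reCLM.contDiff.comp hg).mul (Complex.reCLM.contDiff.comp hh)).add
    ((Complex.imCLM.contDiff.comp hg).mul (Complex.imCLM.contDiff.comp hh))

lemma dot_self_ne {z : ℂ} (hz : z ≠ 0) : dot z z ≠ 0 := by
  have : dot z z = Complex.normSq z := by simp [dot, Complex.normSq_apply]
  rw [this]
  exact (Complex.normSq_pos.2 hz).ne'

/-- every smooth family of closed curves can be reparametrized by a smooth
family of diffeomorphisms of the circle (starting at the identity) so that the resulting
path is horizontal: ⟨∂_t e, ∂_θ e⟩ = 0 everywhere, where e(t,θ) = c(t, φ(t,θ)). -/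
theorem stmt7 (c : ℝ → ℝ → ℂ)
    (hc : ContDiff ℝ (⊤ : ℕ∞) (fun p : ℝ × ℝ => c p.1 p.2))
    (hcper : ∀ t θ, c t (θ + 2 * π) = c t θ)
    (hcimm : ∀ t θ, deriv (c t) θ ≠ 0) :
    ∃ φ : ℝ → ℝ → ℝ,
      ContDiff ℝ (⊤ : ℕ∞) (fun p : ℝ × ℝ => φ p.1 p.2) ∧
      (∀ t θ, φ t (θ + 2 * π) = φ t θ + 2 * π) ∧
      (∀ θ, φ 0 θ = θ) ∧
      (∀ t θ, 0 < deriv (φ t) θ) ∧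
      (∀ t θ, dot (deriv (fun s => c s (φ s θ)) t) (deriv (fun x => c t (φ t x)) θ) = 0) := by
  have hc1 : ContDiff ℝ 1 (fun p : ℝ × ℝ => c p.1 p.2) := hc.of_le (by simp)
  have hx : ContDiff ℝ (⊤ : ℕ∞) (fun p : ℝ × ℝ => deriv (c p.1) p.2) :=
    contDiff_dsnd (by simpa using hc)
  have ht : ContDiff ℝ (⊤ : ℕ∞) (fun p : ℝ × ℝ => deriv (fun s => c s p.2) p.1) :=
    contDiff_dfst (by simpa using hc)
  obtain ⟨φ, h1, h2, h3, h4, h5⟩ := exists_flow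
    (f := fun t x => -dot (deriv (fun s => c s x) t) (deriv (c t) x)
      / dot (deriv (c t) x) (deriv (c t) x))
    ((dot_contDiff ht hx).neg.div (dot_contDiff hx hx) fun p => dot_self_ne (hcimm p.1 p.2))
    (by
      intro t x
      have e1 : deriv (c t) (x + 2 * π) = deriv (c t) x := by
        rw [← deriv_comp_add_const]
        congr 1
        ext1 y
        exact hcper t y
      simp only [hcper, e1])
  refine ⟨φ, h1, h2, h3, h4, fun t θ => ?_⟩
  have hfd := ((hc1.differentiable (by simp)) (t, φ t θ)).hasFDerivAt
  have ct := (hasDerivAt_fst hc1 t (φ t θ)).deriv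
  have cx := (hasDerivAt_snd hc1 t (φ t θ)).deriv
  have hφx := ((hasDerivAt_snd (h1.of_le (by simp)) t θ).differentiableAt).hasDerivAt
  have d2 : HasDerivAt (fun x => c t (φ t x)) (deriv (φ t) θ • deriv (c t) (φ t θ)) θ :=
    HasDerivAt.scomp θ (hasDerivAt_snd hc1 t (φ t θ)).differentiableAt.hasDerivAt hφx
  have hφt := h5 t θ
  set v := -dot (deriv (fun s => c s (φ t θ)) t) (deriv (c t) (φ t θ))
      / dot (deriv (c t) (φ t θ)) (deriv (c t) (φ t θ)) with hv
  have d1 : HasDerivAt (fun s => c s (φ s θ))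
      (deriv (fun s => c s (φ t θ)) t + v • deriv (c t) (φ t θ)) t := by
    have hcurve : HasDerivAt (fun s : ℝ => (s, φ s θ)) ((1 : ℝ), v) t :=
      (hasDerivAt_id t).prodMk hφt
    have := hfd.comp_hasDerivAt t hcurve
    refine this.congr_deriv ?_
    rw [ct, cx, ← map_smul, ← map_add]
    simp
  rw [d1.deriv, d2.deriv]
  have hne := dot_self_ne (hcimm t (φ t θ))
  have hvm : v * dot (deriv (c t) (φ t θ)) (deriv (c t) (φ t θ))
      = -dot (deriv (fun s => c s (φ t θ)) t) (deriv (c t) (φ t θ)) := by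
    rw [hv, div_mul_cancel₀ _ hne]
  generalize deriv (fun s => c s (φ t θ)) t = A at *
  generalize deriv (c t) (φ t θ) = B at *
  simp only [dot, Complex.add_re, Complex.add_im, Complex.real_smul, Complex.mul_re, Complex.mul_im,
    Complex.ofReal_re, Complex.ofReal_im, zero_mul, sub_zero, add_zero] at hvm ⊢
  linear_combination deriv (φ t) θ * hvm
end

section
/- Let A > 0 and let c : ℝ × ℝ → ℝ² be a smooth family of closed curves which is horizontal, i.e. ⟨∂_t c(t,θ), ∂_θ c(t,θ)⟩ = 0 for all (t,θ). Write ℓ(t) = ℓ(c(t,·)) and G^{SI}(t) = ∫ (ℓ(t)^{−3} + A κ²/ℓ(t)) |∂_t c|² ds (the scale invariant norm of the velocity). Then for every t, |d/dt log ℓ(t)| ≤ A^{−1/2} · G^{SI}(t)^{1/2}; consequently |log ℓ(1) − log ℓ(0)| ≤ A^{−1/2} ∫₀¹ G^{SI}(t)^{1/2} dt, i.e. log of the length is Lipschitz with constant 1/√A with respect to G^{SI}-path length. -/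
open Real MeasureTheory

lemma dot_hasDerivAt {f g : ℝ → ℂ} {f' g' : ℂ} {t : ℝ} (hf : HasDerivAt f f' t)
    (hg : HasDerivAt g g' t) :
    HasDerivAt (fun s => dot (f s) (g s)) (dot f' (g t) + dot (f t) g') t := by
  have h1 : HasDerivAt (fun s => (f s).re) f'.re t :=
    Complex.reCLM.hasFDerivAt.comp_hasDerivAt t hf
  have h2 : HasDerivAt (fun s => (f s).im) f'.im t :=
    Complex.imCLM.hasFDerivAt.comp_hasDerivAt t hf
  have h3 : HasDerivAt (fun s => (g s).re) g'.re t :=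
    Complex.reCLM.hasFDerivAt.comp_hasDerivAt t hg
  have h4 : HasDerivAt (fun s => (g s).im) g'.im t :=
    Complex.imCLM.hasFDerivAt.comp_hasDerivAt t hg
  have := (h1.mul h3).add (h2.mul h4)
  unfold dot
  convert! this using 1
  ring

lemma dot_self_eq (w : ℂ) : dot w w = ‖w‖ ^ 2 := by
  rw [Complex.sq_norm, Complex.normSq_apply]; rfl

lemma dot_comm' (v w : ℂ) : dot v w = dot w v := by
  unfold dot; ring

/-- Pointwise plane geometry: for `v ⟂ w`. -/
lemma dot_key (v w u : ℂ) (h : dot v w = 0) (hw : w ≠ 0) :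
    (dot v u / ‖w‖) ^ 2 = (dot (Complex.I * w) u / ‖w‖ ^ 3) ^ 2 * ‖v‖ ^ 2 * ‖w‖ ^ 2 := by
  have hn : ‖w‖ ≠ 0 := norm_ne_zero_iff.2 hw
  have e1 : dot v u * ‖w‖ ^ 2 = dot (Complex.I * w) v * dot (Complex.I * w) u := by
    have : dot v u * dot w w
        = dot v w * dot u w + dot (Complex.I * w) v * dot (Complex.I * w) u := by
      simp [dot]; ring
    rw [← dot_self_eq, this, h]; ring
  have e2 : ‖v‖ ^ 2 * ‖w‖ ^ 2 = dot (Complex.I * w) v ^ 2 := by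
    have : dot v v * dot w w = dot v w ^ 2 + dot (Complex.I * w) v ^ 2 := by
      simp [dot]; ring
    rw [← dot_self_eq, ← dot_self_eq, this, h]; ring
  have e3 : dot v u ^ 2 * ‖w‖ ^ 4 = dot (Complex.I * w) u ^ 2 * (‖v‖ ^ 2 * ‖w‖ ^ 2) := by
    rw [e2]
    calc _ = (dot v u * ‖w‖ ^ 2) ^ 2 := by ring
      _ = _ := by rw [e1]; ring
  rw [mul_assoc, div_pow, div_pow, div_mul_eq_mul_div, ← e3]
  field_simp

/-- Cauchy–Schwarz with weight. -/
lemma weighted_cs (D N : ℝ → ℝ) (hD : Continuous D) (hN : Continuous N) (hpos : ∀ x, 0 < N x) :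
    (∫ x in (0:ℝ)..2 * π, D x) ^ 2
      ≤ (∫ x in (0:ℝ)..2 * π, N x) * ∫ x in (0:ℝ)..2 * π, D x ^ 2 / N x := by
  have hp : (0:ℝ) < 2 * π := by positivity
  have hL : 0 < ∫ x in (0:ℝ)..2 * π, N x :=
    intervalIntegral.intervalIntegral_pos_of_pos (hN.intervalIntegrable _ _) hpos hp
  set L := ∫ x in (0:ℝ)..2 * π, N x with hLdef
  set K := ∫ x in (0:ℝ)..2 * π, D x with hKdef
  have hc : Continuous fun x => D x ^ 2 / N x := (hD.pow 2).div hN fun x => (hpos x).ne'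
  have h0 : 0 ≤ ∫ x in (0:ℝ)..2 * π, (D x ^ 2 / N x - (2 * (K / L)) * D x + (K / L) ^ 2 * N x) := by
    apply intervalIntegral.integral_nonneg hp.le
    intro x _
    have : D x ^ 2 / N x - (2 * (K / L)) * D x + (K / L) ^ 2 * N x
        = (D x - K / L * N x) ^ 2 / N x := by
      have := (hpos x).ne'
      field_simp
      ring
    rw [this]
    exact div_nonneg (sq_nonneg _) (hpos x).le
  rw [intervalIntegral.integral_add, intervalIntegral.integral_sub,
    intervalIntegral.integral_const_mul, intervalIntegral.integral_const_mul,
    ← hLdef, ← hKdef] at h0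
  · have : K ^ 2 / L ≤ ∫ x in (0:ℝ)..2 * π, D x ^ 2 / N x := by
      have e : 2 * (K / L) * K - (K / L) ^ 2 * L = K ^ 2 / L := by field_simp; ring
      linarith
    rw [div_le_iff₀ hL] at this
    linarith
  all_goals apply Continuous.intervalIntegrable; fun_prop

/-- Differentiation under the integral sign. -/
lemma hasDerivAt_param (N D : ℝ → ℝ → ℝ) (hN : Continuous N.uncurry) (hD : Continuous D.uncurry)
    (h : ∀ t θ, HasDerivAt (fun s => N s θ) (D t θ) t) (a b t : ℝ) :
    HasDerivAt (fun s => ∫ θ in a..b, N s θ) (∫ θ in a..b, D t θ) t := by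
  obtain ⟨C, hC⟩ := ((isCompact_closedBall t 1).prod (isCompact_uIcc (a := a) (b := b))
    ).exists_bound_of_continuousOn hD.continuousOn
  refine (intervalIntegral.hasDerivAt_integral_of_dominated_loc_of_deriv_le (bound := fun _ => C)
    (Metric.closedBall_mem_nhds t one_pos) ?_ ?_ ?_ ?_ ?_ ?_).2
  · refine Filter.Eventually.of_forall fun s => Continuous.aestronglyMeasurable ?_
    exact hN.comp (by fun_prop : Continuous fun θ : ℝ => (s, θ))
  · exact Continuous.intervalIntegrable
      (hN.comp (by fun_prop : Continuous fun θ : ℝ => (t, θ))) _ _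
  · exact Continuous.aestronglyMeasurable
      (hD.comp (by fun_prop : Continuous fun θ : ℝ => (t, θ)))
  · refine Filter.Eventually.of_forall fun θ hθ s hs => ?_
    exact hC (s, θ) ⟨hs, Set.uIoc_subset_uIcc hθ⟩
  · exact intervalIntegrable_const
  · exact Filter.Eventually.of_forall fun θ _ s _ => h s θ

lemma hasDerivAt_fst_s10 {E : Type*} [NormedAddCommGroup E] [NormedSpace ℝ E] {F : ℝ × ℝ → E}
    (hF : Differentiable ℝ F) (t θ : ℝ) :
    HasDerivAt (fun s => F (s, θ)) (fderiv ℝ F (t, θ) (1, 0)) t :=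
  (hF (t, θ)).hasFDerivAt.comp_hasDerivAt t ((hasDerivAt_id t).prodMk (hasDerivAt_const t θ))

lemma hasDerivAt_snd_s10 {E : Type*} [NormedAddCommGroup E] [NormedSpace ℝ E] {F : ℝ × ℝ → E}
    (hF : Differentiable ℝ F) (t θ : ℝ) :
    HasDerivAt (fun s => F (t, s)) (fderiv ℝ F (t, θ) (0, 1)) θ :=
  (hF (t, θ)).hasFDerivAt.comp_hasDerivAt θ ((hasDerivAt_const θ t).prodMk (hasDerivAt_id θ))

lemma contDiff_partial {F : ℝ × ℝ → ℂ}
    (hF : ContDiff ℝ (⊤ : ℕ∞) F) (e : ℝ × ℝ) :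
    ContDiff ℝ (⊤ : ℕ∞) (fun p => fderiv ℝ F p e) :=
  (hF.fderiv_right (m := (⊤ : ℕ∞)) (by simp)).clm_apply contDiff_const

lemma mixed_partial {F : ℝ × ℝ → ℂ} (hF : ContDiff ℝ (⊤ : ℕ∞) F) (p e e' : ℝ × ℝ) :
    fderiv ℝ (fun p => fderiv ℝ F p e) p e' = fderiv ℝ (fun p => fderiv ℝ F p e') p e := by
  have hd : DifferentiableAt ℝ (fderiv ℝ F) p :=
    (hF.fderiv_right (m := (⊤ : ℕ∞)) (by simp)).differentiable (by simp) p
  have hs : IsSymmSndFDerivAt ℝ F p :=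
    hF.contDiffAt.isSymmSndFDerivAt (by simp [minSmoothness_of_isRCLikeNormedField]; exact WithTop.coe_le_coe.2 (le_top (a := (2 : ℕ∞))))
  rw [fderiv_clm_apply hd (differentiableAt_const _), fderiv_clm_apply hd (differentiableAt_const _)]
  simpa using hs.eq e' e

/-- along a horizontal path, log of the length is Lipschitz with constant
1/√A with respect to the path length in the scale invariant metric G^{SI}:
|d/dt log ℓ(t)| ≤ A^{−1/2} G^{SI}(t)^{1/2} and
|log ℓ(1) − log ℓ(0)| ≤ A^{−1/2} ∫₀¹ G^{SI}(t)^{1/2} dt. -/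
theorem stmt10 (A : ℝ) (hA : 0 < A) (c : ℝ → ℝ → ℂ)
    (hc : ContDiff ℝ (⊤ : ℕ∞) (fun p : ℝ × ℝ => c p.1 p.2))
    (hcper : ∀ t θ, c t (θ + 2 * π) = c t θ)
    (hcimm : ∀ t θ, deriv (c t) θ ≠ 0)
    (hhor : ∀ t θ, dot (deriv (fun s => c s θ) t) (deriv (c t) θ) = 0)
    (ℓ : ℝ → ℝ) (hℓ : ∀ t, ℓ t = ∫ θ in (0:ℝ)..2 * π, ‖deriv (c t) θ‖)
    (GSI : ℝ → ℝ)
    (hGSI : ∀ t, GSI t = ∫ θ in (0:ℝ)..2 * π,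
        ((ℓ t ^ 3)⁻¹ + A * curvature (c t) θ ^ 2 / ℓ t)
          * ‖deriv (fun s => c s θ) t‖ ^ 2 * ‖deriv (c t) θ‖) :
    (∀ t, |deriv (fun s => Real.log (ℓ s)) t| ≤ (Real.sqrt A)⁻¹ * Real.sqrt (GSI t)) ∧
      |Real.log (ℓ 1) - Real.log (ℓ 0)|
        ≤ (Real.sqrt A)⁻¹ * ∫ t in (0:ℝ)..1, Real.sqrt (GSI t) := by
  set F : ℝ × ℝ → ℂ := fun p => c p.1 p.2 with hFdef
  set V : ℝ × ℝ → ℂ := fun p => fderiv ℝ F p (1, 0) with hVdef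
  set W : ℝ × ℝ → ℂ := fun p => fderiv ℝ F p (0, 1) with hWdef
  set U : ℝ × ℝ → ℂ := fun p => fderiv ℝ W p (0, 1) with hUdef
  have hn0 : ((⊤ : ℕ∞) : WithTop ℕ∞) ≠ 0 := by simp
  have hV : ContDiff ℝ (⊤ : ℕ∞) V := contDiff_partial hc _
  have hW : ContDiff ℝ (⊤ : ℕ∞) W := contDiff_partial hc _
  have hU : ContDiff ℝ (⊤ : ℕ∞) U := contDiff_partial hW _
  have dV : ∀ t θ, deriv (fun s => c s θ) t = V (t, θ) := fun t θ =>
    (hasDerivAt_fst_s10 (hc.differentiable hn0) t θ).deriv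
  have dW : ∀ t θ, deriv (c t) θ = W (t, θ) := fun t θ =>
    (hasDerivAt_snd_s10 (hc.differentiable hn0) t θ).deriv
  have dU : ∀ t θ, deriv (deriv (c t)) θ = U (t, θ) := fun t θ => by
    rw [show deriv (c t) = fun θ => W (t, θ) from funext (dW t)]
    exact (hasDerivAt_snd_s10 (hW.differentiable hn0) t θ).deriv
  have hW0 : ∀ p, W p ≠ 0 := fun p => by
    have := hcimm p.1 p.2
    rwa [dW] at this
  have hVW : ∀ p, dot (V p) (W p) = 0 := fun p => by
    have := hhor p.1 p.2
    rwa [dW, dV] at this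
  simp only [curvature, dW, dV] at hℓ hGSI
  have dU' : ∀ t θ, deriv (fun θ => W (t, θ)) θ = U (t, θ) := fun t θ =>
    (hasDerivAt_snd_s10 (hW.differentiable hn0) t θ).deriv
  have hdW : ∀ t, deriv (c t) = fun θ => W (t, θ) := fun t => funext (dW t)
  simp only [hdW, dU'] at hGSI
  set N : ℝ × ℝ → ℝ := fun p => ‖W p‖ with hNdef
  have hN : ContDiff ℝ (⊤ : ℕ∞) N := hW.norm ℝ hW0
  have hNpos : ∀ p, 0 < N p := fun p => norm_pos_iff.2 (hW0 p)
  set D : ℝ × ℝ → ℝ := fun p => fderiv ℝ N p (1, 0) with hDdef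
  have hDc : Continuous D := (hN.continuous_fderiv hn0).clm_apply continuous_const
  have hNc : Continuous N := hN.continuous
  have hVc := hV.continuous
  have hWc := hW.continuous
  have hUc := hU.continuous
  -- the derivative of the speed
  have hDeq : ∀ p, D p = - (dot (V p) (U p) / ‖W p‖) := by
    rintro ⟨t, θ⟩
    have h1 : HasDerivAt (fun s => dot (W (s, θ)) (W (s, θ))) _ t :=
      dot_hasDerivAt (hasDerivAt_fst_s10 (hW.differentiable hn0) t θ)
        (hasDerivAt_fst_s10 (hW.differentiable hn0) t θ)
    have h2 : HasDerivAt (fun s => N (s, θ) ^ 2) _ t :=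
      (hasDerivAt_fst_s10 (hN.differentiable hn0) t θ).pow 2
    have e12 : (fun s => N (s, θ) ^ 2) = (fun s => dot (W (s, θ)) (W (s, θ))) := by
      funext s; rw [dot_self_eq]
    rw [e12] at h2
    have h3 := h1.unique h2
    have h4 : HasDerivAt (fun s => dot (V (t, s)) (W (t, s))) _ θ :=
      dot_hasDerivAt (hasDerivAt_snd_s10 (hV.differentiable hn0) t θ)
        (hasDerivAt_snd_s10 (hW.differentiable hn0) t θ)
    have h5 : HasDerivAt (fun s => dot (V (t, s)) (W (t, s))) 0 θ := by
      simp only [hVW]; exact hasDerivAt_const _ _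
    have h6 := h4.unique h5
    have hm : fderiv ℝ V (t, θ) (0, 1) = fderiv ℝ W (t, θ) (1, 0) := mixed_partial hc _ _ _
    rw [hm] at h6
    rw [dot_comm' (W (t, θ))] at h3
    have hpos := hNpos (t, θ)
    have h7 : N (t, θ) * D (t, θ) = - dot (V (t, θ)) (U (t, θ)) := by
      have : (2:ℝ) * (N (t, θ) * D (t, θ)) = 2 * (- dot (V (t, θ)) (U (t, θ))) := by
        simp only [Nat.cast_ofNat, Nat.add_one_sub_one, pow_one] at h3
        simp only [hDdef, hUdef]
        linarith
      linarith
    rw [← neg_div, eq_div_iff hpos.ne', ← h7, mul_comm]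
  set κ : ℝ × ℝ → ℝ := fun p => dot (Complex.I * W p) (U p) / ‖W p‖ ^ 3 with hκdef
  have hD2 : ∀ p, D p ^ 2 / N p = κ p ^ 2 * ‖V p‖ ^ 2 * N p := fun p => by
    rw [hDeq, neg_sq, dot_key _ _ _ (hVW p) (hW0 p), div_eq_iff (hNpos p).ne']
    simp only [hκdef, hNdef]
    ring
  have hκc : Continuous κ := by
    refine Continuous.div ?_ (by fun_prop) fun p => pow_ne_zero _ (hNpos p).ne'
    unfold dot
    fun_prop
  have hp : (0:ℝ) < 2 * π := by positivity
  have hℓd : ∀ t, HasDerivAt ℓ (∫ θ in (0:ℝ)..2 * π, D (t, θ)) t := fun t => by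
    rw [show ℓ = fun t => ∫ θ in (0:ℝ)..2 * π, N (t, θ) from funext hℓ]
    exact hasDerivAt_param (fun t θ => N (t, θ)) (fun t θ => D (t, θ)) hNc hDc
      (fun t θ => hasDerivAt_fst_s10 (hN.differentiable hn0) t θ) _ _ t
  have hℓpos : ∀ t, 0 < ℓ t := fun t => by
    rw [hℓ]
    exact intervalIntegral.intervalIntegral_pos_of_pos
      (Continuous.intervalIntegrable (by fun_prop) _ _) (fun θ => hNpos (t, θ)) hp
  have hℓc : Continuous ℓ := continuous_iff_continuousAt.2 fun t => (hℓd t).continuousAt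
  have hℓ'c : Continuous fun t => ∫ θ in (0:ℝ)..2 * π, D (t, θ) :=
    intervalIntegral.continuous_parametric_intervalIntegral_of_continuous'
      (f := fun t θ => D (t, θ)) hDc _ _
  have hlogd : ∀ t, HasDerivAt (fun s => Real.log (ℓ s))
      ((∫ θ in (0:ℝ)..2 * π, D (t, θ)) / ℓ t) t := fun t => (hℓd t).log (hℓpos t).ne'
  have hGc : Continuous GSI := by
    rw [show GSI = _ from funext hGSI]
    refine intervalIntegral.continuous_parametric_intervalIntegral_of_continuous'
      (f := fun t θ => ((ℓ t ^ 3)⁻¹ + A * κ (t, θ) ^ 2 / ℓ t) * ‖V (t, θ)‖ ^ 2 * N (t, θ)) ?_ _ _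
    have h1 : Continuous fun p : ℝ × ℝ => (ℓ p.1 ^ 3)⁻¹ :=
      Continuous.inv₀ (by fun_prop) fun p => pow_ne_zero _ (hℓpos _).ne'
    have h2 : Continuous fun p : ℝ × ℝ => A * κ p ^ 2 / ℓ p.1 :=
      Continuous.div (by fun_prop) (by fun_prop) fun p => (hℓpos _).ne'
    exact ((h1.add h2).mul (hVc.norm.pow 2)).mul hNc
  have hbound : ∀ t, A * ((∫ θ in (0:ℝ)..2 * π, D (t, θ)) / ℓ t) ^ 2 ≤ GSI t := fun t => by
    have hcs := weighted_cs (fun θ => D (t, θ)) (fun θ => N (t, θ)) (by fun_prop) (by fun_prop)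
      (fun θ => hNpos _)
    have hl := hℓpos t
    have hlN : ∫ θ in (0:ℝ)..2 * π, N (t, θ) = ℓ t := (hℓ t).symm
    rw [hlN] at hcs
    have hle : A / ℓ t * ∫ θ in (0:ℝ)..2 * π, D (t, θ) ^ 2 / N (t, θ) ≤ GSI t := by
      rw [hGSI, ← intervalIntegral.integral_const_mul]
      apply intervalIntegral.integral_mono_on hp.le
      · simp only [hD2]
        exact Continuous.intervalIntegrable (by fun_prop) _ _
      · have h3 : Continuous fun θ : ℝ => κ (t, θ) := by fun_prop
        have h4 : Continuous fun θ : ℝ =>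
            ((ℓ t ^ 3)⁻¹ + A * κ (t, θ) ^ 2 / ℓ t) * ‖V (t, θ)‖ ^ 2 * N (t, θ) := by fun_prop
        exact h4.intervalIntegrable _ _
      · intro θ _
        rw [hD2]
        change _ ≤ ((ℓ t ^ 3)⁻¹ + A * κ (t, θ) ^ 2 / ℓ t) * ‖V (t, θ)‖ ^ 2 * N (t, θ)
        have : 0 ≤ (ℓ t ^ 3)⁻¹ * ‖V (t, θ)‖ ^ 2 * N (t, θ) := by
          have := (hNpos (t, θ)).le
          positivity
        have e : ((ℓ t ^ 3)⁻¹ + A * κ (t, θ) ^ 2 / ℓ t) * ‖V (t, θ)‖ ^ 2 * N (t, θ)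
          = (ℓ t ^ 3)⁻¹ * ‖V (t, θ)‖ ^ 2 * N (t, θ)
            + A / ℓ t * (κ (t, θ) ^ 2 * ‖V (t, θ)‖ ^ 2 * N (t, θ)) := by ring
        linarith
    refine le_trans ?_ hle
    calc _ = A / ℓ t ^ 2 * (∫ θ in (0:ℝ)..2 * π, D (t, θ)) ^ 2 := by ring
      _ ≤ A / ℓ t ^ 2 * (ℓ t * ∫ θ in (0:ℝ)..2 * π, D (t, θ) ^ 2 / N (t, θ)) := by
        gcongr
      _ = _ := by field_simp
  have hder : ∀ t, |(∫ θ in (0:ℝ)..2 * π, D (t, θ)) / ℓ t|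
      ≤ (Real.sqrt A)⁻¹ * Real.sqrt (GSI t) := fun t => by
    rw [inv_mul_eq_div]
    rw [le_div_iff₀ (Real.sqrt_pos.2 hA), ← Real.sqrt_sq_eq_abs, ← Real.sqrt_mul (sq_nonneg _)]
    apply Real.sqrt_le_sqrt
    rw [mul_comm]
    exact hbound t
  refine ⟨fun t => by rw [(hlogd t).deriv]; exact hder t, ?_⟩
  have hqc : Continuous fun t => (∫ θ in (0:ℝ)..2 * π, D (t, θ)) / ℓ t :=
    hℓ'c.div hℓc fun t => (hℓpos t).ne'
  rw [← intervalIntegral.integral_eq_sub_of_hasDerivAt (fun t _ => hlogd t)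
    (hqc.intervalIntegrable _ _), ← intervalIntegral.integral_const_mul]
  refine (intervalIntegral.abs_integral_le_integral_abs zero_le_one).trans ?_
  apply intervalIntegral.integral_mono_on zero_le_one
  · exact hqc.abs.intervalIntegrable _ _
  · exact Continuous.intervalIntegrable (by fun_prop) _ _
  · exact fun t _ => hder t
end

section
/- Let Φ : (0,∞) × (0,∞) → (0,∞) be continuous, and let a, b ∈ ℝ and C₁, C₂ > 0 be such that Φ(2πr, 1/r)/rᵃ → C₁ as r → 0⁺ and Φ(2πr, 1/r)/r^b → C₂ as r → ∞. Then ∫₀¹ √(2πr · Φ(2πr, 1/r)) dr = ∞ if and only if a ≤ −3, and ∫₁^∞ √(2πr · Φ(2πr, 1/r)) dr = ∞ if and only if b ≥ −3. (These integrals are the lengths, toward r = 0 and r = ∞ respectively, of the geodesic of concentric circles c(t,θ) = r(t)e^{iθ} in the metric G^Φ, whose energy density is G^Φ(c_t, c_t) = 2πr Φ(2πr, 1/r) r_t²; hence this geodesic is complete at r = 0 iff a ≤ −3 and complete at r = ∞ iff b ≥ −3.) -/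
open Real MeasureTheory Filter

lemma aux_A {f : ℝ → ℝ} (hf : ContinuousOn f (Set.Ioi 0)) :
    IntegrableOn f (Set.Ioo 0 1) ↔ IntegrableAtFilter f (nhdsWithin 0 (Set.Ioi 0)) volume := by
  constructor
  · intro h
    exact ⟨_, Ioo_mem_nhdsGT one_pos, h⟩
  · rintro ⟨s, hs, h⟩
    obtain ⟨u, hu, hsub⟩ := mem_nhdsGT_iff_exists_Ioo_subset.1 hs
    have hu' : 0 < u := hu
    have h1 : IntegrableOn f (Set.Icc u 1) :=
      (hf.mono (fun x hx => lt_of_lt_of_le hu' hx.1)).integrableOn_Icc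
    refine ((h.mono_set hsub).union h1).mono_set ?_
    intro x hx
    rcases lt_or_ge x u with h2 | h2
    · exact Or.inl ⟨hx.1, h2⟩
    · exact Or.inr ⟨h2, hx.2.le⟩

lemma aux_B {f : ℝ → ℝ} (hf : ContinuousOn f (Set.Ioi 0)) :
    IntegrableOn f (Set.Ioi 1) ↔ IntegrableAtFilter f atTop volume := by
  constructor
  · intro h
    exact ⟨_, Ioi_mem_atTop 1, h⟩
  · rintro ⟨s, hs, h⟩
    obtain ⟨u, hu⟩ := mem_atTop_sets.1 hs
    have h1 : IntegrableOn f (Set.Icc 1 u) :=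
      (hf.mono (fun x hx => lt_of_lt_of_le one_pos hx.1)).integrableOn_Icc
    refine ((h.mono_set (s := Set.Ici u) hu).union h1).mono_set ?_
    intro x hx
    rcases lt_or_ge x u with h2 | h2
    · exact Or.inr ⟨le_of_lt hx, h2.le⟩
    · exact Or.inl h2

lemma aux_top {f : ℝ → ℝ} (hf : ContinuousOn f (Set.Ioi 0)) (h0 : ∀ x, 0 ≤ f x)
    {s : Set ℝ} (hs : MeasurableSet s) (hsub : s ⊆ Set.Ioi 0) :
    (∫⁻ r in s, ENNReal.ofReal (f r) = ⊤) ↔ ¬ IntegrableOn f s := by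
  have hm : AEStronglyMeasurable f (volume.restrict s) :=
    (hf.mono hsub).aestronglyMeasurable hs
  rw [IntegrableOn, ← lintegral_ofReal_ne_top_iff_integrable hm (ae_of_all _ h0), not_not]

lemma aux_filter {f g : ℝ → ℝ} {l : Filter ℝ} [l.IsMeasurablyGenerated] (hl : Set.Ioi 0 ∈ l)
    (hf : ContinuousOn f (Set.Ioi 0)) (hg : ContinuousOn g (Set.Ioi 0))
    (hfg : f =Θ[l] g) :
    IntegrableAtFilter f l volume ↔ IntegrableAtFilter g l volume := by
  have mf : StronglyMeasurableAtFilter f l volume :=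
    ⟨_, hl, hf.aestronglyMeasurable measurableSet_Ioi⟩
  have mg : StronglyMeasurableAtFilter g l volume :=
    ⟨_, hl, hg.aestronglyMeasurable measurableSet_Ioi⟩
  exact ⟨fun h => hfg.2.integrableAtFilter mg h, fun h => hfg.1.integrableAtFilter mf h⟩

lemma aux_theta {F : ℝ → ℝ} {l : Filter ℝ} (hl : Set.Ioi 0 ∈ l) {a C : ℝ} (hC : 0 < C)
    (h : Tendsto (fun r : ℝ => F r / r ^ a) l (nhds C)) :
    (fun r : ℝ => √(2 * π * r * F r)) =Θ[l] (fun r : ℝ => r ^ ((a + 1) / 2)) := by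
  have h1 : Tendsto (fun r : ℝ => √(2 * π * (F r / r ^ a))) l (nhds √(2 * π * C)) :=
    (h.const_mul _).sqrt
  have h2 : √(2 * π * C) ≠ 0 := by positivity
  have h3 : Tendsto (fun r : ℝ => √(2 * π * r * F r) / r ^ ((a + 1) / 2)) l
      (nhds √(2 * π * C)) := by
    refine h1.congr' ?_
    filter_upwards [hl] with r hr
    have hr : 0 < r := hr
    have h4 : r ^ ((a + 1) / 2) = √(r ^ a * r) := by
      rw [← Real.rpow_add_one hr.ne', Real.sqrt_eq_rpow, ← Real.rpow_mul hr.le]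
      congr 1; ring
    have hp : 0 < r ^ a := Real.rpow_pos_of_pos hr a
    rw [h4, ← Real.sqrt_div' _ (by positivity)]
    congr 1
    field_simp
  exact (Asymptotics.isTheta_of_div_tendsto_nhds_ne_zero h3 h2).symm

lemma aux_g (s : ℝ) : ContinuousOn (fun r : ℝ => r ^ s) (Set.Ioi 0) := fun x hx =>
  (Real.continuousAt_rpow_const x s (Or.inl (ne_of_gt hx))).continuousWithinAt

/-- the geodesic of concentric circles in the almost local metric G^Φ,
whose length as r ranges over an interval is ∫ √(2πr Φ(2πr, 1/r)) dr, has infinite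
length toward r = 0 iff a ≤ −3 and infinite length toward r = ∞ iff b ≥ −3, where
Φ(2πr, 1/r) ≈ C₁ rᵃ as r → 0⁺ and ≈ C₂ r^b as r → ∞. -/
theorem stmt14 (Φ : ℝ → ℝ → ℝ)
    (hΦcont : ContinuousOn (fun p : ℝ × ℝ => Φ p.1 p.2) (Set.Ioi 0 ×ˢ Set.Ioi 0))
    (hΦpos : ∀ x y : ℝ, 0 < x → 0 < y → 0 < Φ x y)
    (a b C₁ C₂ : ℝ) (hC₁ : 0 < C₁) (hC₂ : 0 < C₂)
    (h0 : Tendsto (fun r : ℝ => Φ (2 * π * r) (1 / r) / r ^ a) (nhdsWithin 0 (Set.Ioi 0))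
      (nhds C₁))
    (hinf : Tendsto (fun r : ℝ => Φ (2 * π * r) (1 / r) / r ^ b) atTop (nhds C₂)) :
    ((∫⁻ r in Set.Ioo (0:ℝ) 1,
        ENNReal.ofReal (Real.sqrt (2 * π * r * Φ (2 * π * r) (1 / r))) = ⊤) ↔ a ≤ -3) ∧
    ((∫⁻ r in Set.Ioi (1:ℝ),
        ENNReal.ofReal (Real.sqrt (2 * π * r * Φ (2 * π * r) (1 / r))) = ⊤) ↔ -3 ≤ b) := by
  have hf : ContinuousOn (fun r : ℝ => √(2 * π * r * Φ (2 * π * r) (1 / r))) (Set.Ioi 0) := by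
    refine Real.continuous_sqrt.comp_continuousOn (ContinuousOn.mul (by fun_prop) ?_)
    refine hΦcont.comp (f := fun r : ℝ => (2 * π * r, 1 / r)) ?_ ?_
    · refine ContinuousOn.prodMk (by fun_prop) ?_
      exact continuousOn_const.div continuousOn_id (fun x hx => ne_of_gt hx)
    · intro r hr
      have hr : 0 < r := hr
      exact ⟨by simp only [Set.mem_Ioi]; positivity, by simp only [Set.mem_Ioi]; positivity⟩
  have hn : ∀ r : ℝ, 0 ≤ √(2 * π * r * Φ (2 * π * r) (1 / r)) := fun r => Real.sqrt_nonneg _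
  constructor
  · rw [aux_top hf hn measurableSet_Ioo (fun x hx => hx.1), aux_A hf,
      aux_filter self_mem_nhdsWithin hf (aux_g _) (aux_theta self_mem_nhdsWithin hC₁ h0),
      ← aux_A (aux_g _), intervalIntegral.integrableOn_Ioo_rpow_iff one_pos]
    constructor <;> intro h <;> linarith
  · rw [aux_top hf hn measurableSet_Ioi (Set.Ioi_subset_Ioi zero_le_one), aux_B hf,
      aux_filter (Ioi_mem_atTop 0) hf (aux_g _) (aux_theta (Ioi_mem_atTop 0) hC₂ hinf),
      ← aux_B (aux_g _), integrableOn_Ioi_rpow_iff one_pos]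
    constructor <;> intro h <;> linarith
end

section
/- Let Φ(ℓ, κ) = 4π²/ℓ³ + κ²/ℓ (the scale invariant case). Then for every r > 0, 2πr · Φ(2πr, 1/r) = 2/r². Consequently, for r₀ > 0 and c ∈ ℝ, the family of concentric circles of radii r(t) = r₀ e^{ct} has constant speed: 2πr(t) Φ(2πr(t), 1/r(t)) · r'(t)² = 2c² for all t; moreover ∫₀¹ √(2πr Φ(2πr,1/r)) dr = ∫₀¹ (√2/r) dr = ∞ and ∫₁^∞ √(2πr Φ(2πr,1/r)) dr = ∞, so the geodesic of concentric circles is complete in both directions. -/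
open Real MeasureTheory

theorem lintegral_top_of_not_integrableOn (f : ℝ → ℝ) (S : Set ℝ) (hS : MeasurableSet S)
    (hf : ∀ r ∈ S, f r = Real.sqrt 2 / r) (hpos : ∀ r ∈ S, 0 < r)
    (hn : ¬ IntegrableOn (fun r : ℝ => r⁻¹) S) :
    ∫⁻ r in S, ENNReal.ofReal (f r) = ⊤ := by
  by_contra hne
  apply hn
  have h1 : ∫⁻ r in S, ENNReal.ofReal (f r) = ∫⁻ r in S, ENNReal.ofReal (Real.sqrt 2 * r⁻¹) := by
    apply setLIntegral_congr_fun hS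
    intro r hr
    simp only [hf r hr, div_eq_mul_inv]
  rw [h1] at hne
  have hm : Measurable (fun r : ℝ => Real.sqrt 2 * r⁻¹) := by fun_prop
  have h2 : IntegrableOn (fun r : ℝ => Real.sqrt 2 * r⁻¹) S := by
    refine (lintegral_ofReal_ne_top_iff_integrable hm.aestronglyMeasurable ?_).1 hne
    filter_upwards [ae_restrict_mem hS] with r hr
    have := hpos r hr
    simp only [Pi.zero_apply]
    positivity
  have h3 : IntegrableOn (fun r : ℝ => (Real.sqrt 2)⁻¹ * (Real.sqrt 2 * r⁻¹)) S := h2.const_mul _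
  have h4 : Real.sqrt 2 ≠ 0 := by positivity
  simpa [← mul_assoc, h4] using h3

/-- for the scale invariant Φ(ℓ,κ) = 4π²/ℓ³ + κ²/ℓ one has
2πr·Φ(2πr, 1/r) = 2/r², the exponential family r(t) = r₀e^{ct} of concentric circles has
constant speed 2c², the integrand of the path length is √2/r, and the geodesic of
concentric circles has infinite length toward both r = 0 and r = ∞, hence is complete. -/
theorem stmt15 (Φ : ℝ → ℝ → ℝ) (hΦ : ∀ l k : ℝ, Φ l k = 4 * π ^ 2 / l ^ 3 + k ^ 2 / l)
    (r₀ c : ℝ) (hr₀ : 0 < r₀) :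
    (∀ r : ℝ, 0 < r → 2 * π * r * Φ (2 * π * r) (1 / r) = 2 / r ^ 2) ∧
    (∀ t : ℝ,
        2 * π * (r₀ * Real.exp (c * t))
            * Φ (2 * π * (r₀ * Real.exp (c * t))) (1 / (r₀ * Real.exp (c * t)))
            * (deriv (fun s : ℝ => r₀ * Real.exp (c * s)) t) ^ 2
          = 2 * c ^ 2) ∧
    (∀ r : ℝ, 0 < r →
        Real.sqrt (2 * π * r * Φ (2 * π * r) (1 / r)) = Real.sqrt 2 / r) ∧
    (∫⁻ r in Set.Ioo (0:ℝ) 1,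
        ENNReal.ofReal (Real.sqrt (2 * π * r * Φ (2 * π * r) (1 / r))) = ⊤) ∧
    (∫⁻ r in Set.Ioi (1:ℝ),
        ENNReal.ofReal (Real.sqrt (2 * π * r * Φ (2 * π * r) (1 / r))) = ⊤) := by
  have hA : ∀ r : ℝ, 0 < r → 2 * π * r * Φ (2 * π * r) (1 / r) = 2 / r ^ 2 := by
    intro r hr
    have hpi := Real.pi_pos
    rw [hΦ]
    field_simp
    ring
  have hB : ∀ r : ℝ, 0 < r →
      Real.sqrt (2 * π * r * Φ (2 * π * r) (1 / r)) = Real.sqrt 2 / r := by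
    intro r hr
    rw [hA r hr, Real.sqrt_div (by norm_num), Real.sqrt_sq hr.le]
  refine ⟨hA, ?_, hB, ?_, ?_⟩
  · intro t
    have hp : 0 < r₀ * Real.exp (c * t) := by positivity
    have hd : HasDerivAt (fun s : ℝ => r₀ * Real.exp (c * s)) (r₀ * (Real.exp (c * t) * (c * 1))) t :=
      (((hasDerivAt_id t).const_mul c).exp).const_mul r₀
    rw [hA _ hp, hd.deriv]
    have := Real.exp_pos (c * t)
    field_simp
  · refine lintegral_top_of_not_integrableOn _ _ measurableSet_Ioo (fun r hr => hB r hr.1)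
      (fun r hr => hr.1) ?_
    intro h
    have h' : IntervalIntegrable (fun r : ℝ => r⁻¹) volume 0 1 := by
      rw [intervalIntegrable_iff_integrableOn_Ioo_of_le zero_le_one]
      exact h
    rw [intervalIntegrable_inv_iff] at h'
    simp at h'
  · refine lintegral_top_of_not_integrableOn _ _ measurableSet_Ioi
      (fun r hr => hB r (zero_lt_one.trans hr)) (fun r hr => zero_lt_one.trans hr) ?_
    exact not_integrableOn_Ioi_inv
end

section
/- Let A > 0 and let n ≥ 1 be an integer. Then ∫₁^∞ √(2πr(1 + A r^{−2n})) dr = ∞, and ∫₀¹ √(2πr(1 + A r^{−2n})) dr = ∞ if and only if n ≥ 2. (These integrals are the lengths toward r = ∞ and r = 0 of the geodesic of concentric circles in the metric G^{imm,n}; hence this geodesic is complete for n ≥ 2, while for n = 1 it is incomplete as r → 0 but complete as r → ∞.) -/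
open Real MeasureTheory

/-- the geodesic of concentric circles in the metric G^{imm,n}, whose length
as r ranges over an interval is ∫ √(2πr(1 + A r^{−2n})) dr, has infinite length toward
r = ∞, and infinite length toward r = 0 if and only if n ≥ 2; so it is complete for n ≥ 2
and, for n = 1, incomplete as r → 0 but complete as r → ∞. -/
theorem stmt17 (A : ℝ) (hA : 0 < A) (n : ℕ) (hn : 1 ≤ n) :
    (∫⁻ r in Set.Ioi (1:ℝ),
        ENNReal.ofReal (Real.sqrt (2 * π * r * (1 + A / r ^ (2 * n)))) = ⊤) ∧
    ((∫⁻ r in Set.Ioo (0:ℝ) 1,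
        ENNReal.ofReal (Real.sqrt (2 * π * r * (1 + A / r ^ (2 * n)))) = ⊤) ↔ 2 ≤ n) := by
  have key : ∀ s : Set ℝ, (∫⁻ r in s,
      ENNReal.ofReal (Real.sqrt (2 * π * r * (1 + A / r ^ (2 * n)))) = ⊤) ↔
      ¬ IntegrableOn (fun r : ℝ => Real.sqrt (2 * π * r * (1 + A / r ^ (2 * n)))) s := by
    intro s
    rw [IntegrableOn, ← lintegral_ofReal_ne_top_iff_integrable, not_not]
    · exact (by fun_prop : Measurable _).aestronglyMeasurable
    · exact Filter.Eventually.of_forall fun r => Real.sqrt_nonneg _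
  have hpi := Real.pi_gt_three
  refine ⟨?_, ?_⟩
  · rw [eq_top_iff]
    calc (⊤ : ENNReal) = ∫⁻ r in Set.Ioi (1:ℝ), 1 := by simp
      _ ≤ _ := by
        refine setLIntegral_mono' measurableSet_Ioi fun r hr => ?_
        have hr : 1 < r := hr
        rw [← ENNReal.ofReal_one]
        apply ENNReal.ofReal_le_ofReal
        rw [Real.one_le_sqrt]
        have h1 : 0 ≤ A / r ^ (2 * n) := by positivity
        have h2 : 1 ≤ 2 * π * r := by nlinarith
        nlinarith
  · rw [key]
    constructor
    · intro h
      by_contra hlt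
      obtain rfl : n = 1 := by omega
      apply h
      have hi : IntegrableOn (fun r : ℝ => Real.sqrt (2 * π * (1 + A)) * r ^ (-(1/2) : ℝ))
          (Set.Ioo 0 1) :=
        ((intervalIntegral.integrableOn_Ioo_rpow_iff (by norm_num)).2 (by norm_num)).const_mul _
      refine Integrable.mono' hi (by fun_prop : Measurable _).aestronglyMeasurable ?_
      refine (ae_restrict_iff' measurableSet_Ioo).2 (Filter.Eventually.of_forall fun r hr => ?_)
      obtain ⟨h0, h1⟩ := hr
      rw [Real.norm_of_nonneg (Real.sqrt_nonneg _), Real.rpow_neg h0.le, ← Real.sqrt_eq_rpow,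
        ← Real.sqrt_inv, ← Real.sqrt_mul (by positivity)]
      apply Real.sqrt_le_sqrt
      have e : 2 * π * r * (1 + A / r ^ (2 * 1)) = 2 * π * (r ^ 2 + A) * r⁻¹ := by
        field_simp
      rw [e]
      have : r ^ 2 ≤ 1 := by nlinarith
      gcongr
    · intro h2 hfull
      have hi : IntegrableOn (fun r : ℝ => Real.sqrt A * r ^ (-1 : ℝ)) (Set.Ioo 0 1) := by
        refine Integrable.mono' hfull (by fun_prop : Measurable _).aestronglyMeasurable ?_
        refine (ae_restrict_iff' measurableSet_Ioo).2 (Filter.Eventually.of_forall fun r hr => ?_)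
        obtain ⟨h0, h1⟩ := hr
        rw [Real.norm_of_nonneg (by positivity), Real.rpow_neg_one]
        apply Real.le_sqrt_of_sq_le
        rw [mul_pow, Real.sq_sqrt hA.le]
        have hp : r ^ (2 * n) ≤ r ^ 3 := pow_le_pow_of_le_one h0.le h1.le (by omega)
        have hd : A / r ^ 3 ≤ A / r ^ (2 * n) := by gcongr
        calc A * r⁻¹ ^ 2 = 1 * r * (A / r ^ 3) := by field_simp
          _ ≤ 2 * π * r * (1 + A / r ^ (2 * n)) := by
            gcongr
            · linarith
            · linarith
      have hi2 := hi.const_mul (Real.sqrt A)⁻¹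
      have hs : Real.sqrt A ≠ 0 := (Real.sqrt_pos.2 hA).ne'
      simp only [inv_mul_cancel_left₀ hs] at hi2
      have := (intervalIntegral.integrableOn_Ioo_rpow_iff (by norm_num : (0:ℝ) < 1)).1 hi2
      norm_num at this
end

section
/- Let A > 0 and let c : ℝ × ℝ → ℝ² be a smooth family of closed curves (2π-periodic in θ, with ∂_θ c(t,θ) ≠ 0 everywhere). Write ℓ(t) = ℓ(c(t,·)) and ‖c_t‖(t) = (∫ (|∂_t c|² + A |D_s(∂_t c)|²) ds)^{1/2} (the G^{imm,1}-norm of the velocity). Then for every t, d/dt ℓ(t) ≤ √(ℓ(t)) · A^{−1/2} ‖c_t‖(t), hence d/dt √(ℓ(t)) ≤ (1/(2√A)) ‖c_t‖(t), and therefore |√(ℓ(1)) − √(ℓ(0))| ≤ (1/(2√A)) ∫₀¹ ‖c_t‖(t) dt. (So √ℓ is Lipschitz with respect to G^{imm,1}-path length.) -/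
open Real MeasureTheory

/-- Differentiation under the integral sign for continuous data. -/
lemma hasDerivAt_param_aux (g h : ℝ × ℝ → ℝ) (hg : Continuous g) (hh : Continuous h)
    (hd : ∀ t θ, HasDerivAt (fun s => g (s, θ)) (h (t, θ)) t) (a b t : ℝ) :
    HasDerivAt (fun s => ∫ θ in a..b, g (s, θ)) (∫ θ in a..b, h (t, θ)) t := by
  obtain ⟨C, hC⟩ := ((isCompact_closedBall t 1).prod (isCompact_uIcc (a := a) (b := b))).exists_bound_of_continuousOn
    hh.continuousOn
  refine (intervalIntegral.hasDerivAt_integral_of_dominated_loc_of_deriv_le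
    (F := fun s θ => g (s, θ)) (F' := fun s θ => h (s, θ)) (bound := fun _ => C)
    (Metric.closedBall_mem_nhds t one_pos) ?_ ?_ ?_ ?_ ?_ ?_).2
  · exact Filter.Eventually.of_forall fun s =>
      (show Continuous fun θ => g (s, θ) by fun_prop).aestronglyMeasurable
  · exact (show Continuous fun θ => g (t, θ) by fun_prop).intervalIntegrable _ _
  · exact (show Continuous fun θ => h (t, θ) by fun_prop).aestronglyMeasurable
  · exact Filter.Eventually.of_forall fun θ hθ s hs => hC (s, θ) ⟨hs, Set.uIoc_subset_uIcc hθ⟩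
  · exact intervalIntegrable_const
  · exact Filter.Eventually.of_forall fun θ _ s _ => hd s θ

/-- Cauchy–Schwarz in the form used below. -/
lemma cs_aux (g w : ℝ → ℝ) (hg : Continuous g) (hw : Continuous w) (hpos : ∀ θ, 0 < g θ)
    (a b : ℝ) (hab : a ≤ b) :
    (∫ θ in a..b, w θ) ^ 2 ≤ (∫ θ in a..b, w θ ^ 2 / g θ) * ∫ θ in a..b, g θ := by
  have hne : ∀ θ, g θ ≠ 0 := fun θ => (hpos θ).ne'
  have hq : Continuous fun θ => w θ ^ 2 / g θ := by fun_prop (disch := exact hne _)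
  have key : ∀ x : ℝ, 0 ≤ (∫ θ in a..b, w θ ^ 2 / g θ) * (x * x)
      + (2 * ∫ θ in a..b, w θ) * x + ∫ θ in a..b, g θ := by
    intro x
    have h0 : 0 ≤ ∫ θ in a..b, ((w θ ^ 2 / g θ) * (x * x) + w θ * (2 * x) + g θ) := by
      apply intervalIntegral.integral_nonneg hab
      intro θ _
      have hp := hpos θ
      have : (w θ ^ 2 / g θ) * (x * x) + w θ * (2 * x) + g θ = (w θ * x + g θ) ^ 2 / g θ := by
        field_simp
        ring
      rw [this]
      positivity
    rw [intervalIntegral.integral_add, intervalIntegral.integral_add,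
      intervalIntegral.integral_mul_const, intervalIntegral.integral_mul_const] at h0
    · linarith
    all_goals exact Continuous.intervalIntegrable (by fun_prop) _ _
  have := discrim_le_zero key
  rw [discrim] at this
  nlinarith

lemma hasDerivAt_norm_aux (f : ℝ → ℂ) (f' : ℂ) (t : ℝ) (hf : HasDerivAt f f' t) (h0 : f t ≠ 0) :
    HasDerivAt (fun s => ‖f s‖) (inner ℝ (f t) f' / ‖f t‖) t := by
  have h1 := hf.norm_sq
  have h2 : ‖f t‖ ^ 2 ≠ 0 := by simpa using h0
  have h3 := h1.sqrt h2
  simp only [Real.sqrt_sq (norm_nonneg _)] at h3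
  convert h3 using 1
  ring

set_option maxHeartbeats 1000000 in
/-- along any smooth family of closed curves, writing ℓ(t) for the length
and N(t) for the G^{imm,1}-norm of the velocity, one has
dℓ/dt ≤ √(ℓ) A^{−1/2} N, hence d√ℓ/dt ≤ N/(2√A), and therefore
|√(ℓ(1)) − √(ℓ(0))| ≤ (1/(2√A)) ∫₀¹ N(t) dt: √ℓ is Lipschitz w.r.t. G^{imm,1}-path length. -/
theorem stmt19 (A : ℝ) (hA : 0 < A) (c : ℝ → ℝ → ℂ)
    (hc : ContDiff ℝ (⊤ : ℕ∞) (fun p : ℝ × ℝ => c p.1 p.2))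
    (hcper : ∀ t θ, c t (θ + 2 * π) = c t θ)
    (hcimm : ∀ t θ, deriv (c t) θ ≠ 0)
    (ℓ : ℝ → ℝ) (hℓ : ∀ t, ℓ t = ∫ θ in (0:ℝ)..2 * π, ‖deriv (c t) θ‖)
    (N : ℝ → ℝ)
    (hN : ∀ t, N t = Real.sqrt (∫ θ in (0:ℝ)..2 * π,
        (‖deriv (fun s => c s θ) t‖ ^ 2
          + A * ‖Ds (c t) (fun x => deriv (fun s => c s x) t) θ‖ ^ 2) * ‖deriv (c t) θ‖)) :
    (∀ t, deriv ℓ t ≤ Real.sqrt (ℓ t) * (Real.sqrt A)⁻¹ * N t) ∧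
    (∀ t, deriv (fun s => Real.sqrt (ℓ s)) t ≤ (2 * Real.sqrt A)⁻¹ * N t) ∧
    |Real.sqrt (ℓ 1) - Real.sqrt (ℓ 0)| ≤ (2 * Real.sqrt A)⁻¹ * ∫ t in (0:ℝ)..1, N t := by
  set F : ℝ × ℝ → ℂ := fun p => c p.1 p.2 with hF
  have hFd : ∀ p, HasFDerivAt F (fderiv ℝ F p) p := fun p =>
    (hc.differentiable (by simp) p).hasFDerivAt
  have hF1 : ContDiff ℝ 1 (fderiv ℝ F) := hc.fderiv_right (by norm_cast)
  have hFdd : ∀ p, HasFDerivAt (fderiv ℝ F) (fderiv ℝ (fderiv ℝ F) p) p := fun p =>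
    (hF1.differentiable (by simp) p).hasFDerivAt
  have hFc : Continuous (fderiv ℝ F) := hF1.continuous
  have hFcc : Continuous (fderiv ℝ (fderiv ℝ F)) := hF1.continuous_fderiv (by simp)
  have line1 : ∀ t θ : ℝ, HasDerivAt (fun s : ℝ => (s, θ)) ((1 : ℝ), (0 : ℝ)) t := fun t θ =>
    (hasDerivAt_id t).prodMk (hasDerivAt_const t θ)
  have line2 : ∀ t θ : ℝ, HasDerivAt (fun x : ℝ => (t, x)) ((0 : ℝ), (1 : ℝ)) θ := fun t θ =>
    (hasDerivAt_const θ t).prodMk (hasDerivAt_id θ)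
  -- the three relevant partial derivatives
  obtain ⟨u, hu⟩ : ∃ u : ℝ × ℝ → ℂ, ∀ p, u p = fderiv ℝ F p (0, 1) := ⟨_, fun _ => rfl⟩
  obtain ⟨v, hv⟩ : ∃ v : ℝ × ℝ → ℂ, ∀ p, v p = fderiv ℝ F p (1, 0) := ⟨_, fun _ => rfl⟩
  obtain ⟨w, hw⟩ : ∃ w : ℝ × ℝ → ℂ, ∀ p, w p = fderiv ℝ (fderiv ℝ F) p (0, 1) (1, 0) :=
    ⟨_, fun _ => rfl⟩
  have hsymm : ∀ p, w p = fderiv ℝ (fderiv ℝ F) p (1, 0) (0, 1) := by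
    intro p
    rw [hw]
    exact second_derivative_symmetric hFd (hFdd p) _ _
  have huc : Continuous u := by
    rw [show u = fun p => fderiv ℝ F p (0, 1) from funext hu]; fun_prop
  have hvc : Continuous v := by
    rw [show v = fun p => fderiv ℝ F p (1, 0) from funext hv]; fun_prop
  have hwc : Continuous w := by
    rw [show w = fun p => fderiv ℝ (fderiv ℝ F) p (0, 1) (1, 0) from funext hw]; fun_prop
  have hcu : ∀ t θ, deriv (c t) θ = u (t, θ) := by
    intro t θ
    rw [hu]
    exact ((hFd (t, θ)).comp_hasDerivAt θ (line2 t θ)).deriv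
  have hcv : ∀ t θ, deriv (fun s => c s θ) t = v (t, θ) := by
    intro t θ
    rw [hv]
    exact ((hFd (t, θ)).comp_hasDerivAt t (line1 t θ)).deriv
  have hvw : ∀ t θ, deriv (fun x => v (t, x)) θ = w (t, θ) := by
    intro t θ
    have h1 := ((hFdd (t, θ)).comp_hasDerivAt θ (line2 t θ)).clm_apply
      (hasDerivAt_const θ ((1 : ℝ), (0 : ℝ)))
    simp only [map_zero, add_zero] at h1
    rw [hw, show v = fun p => fderiv ℝ F p (1, 0) from funext hv]
    exact h1.deriv
  have huw : ∀ t θ, HasDerivAt (fun s => u (s, θ)) (w (t, θ)) t := by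
    intro t θ
    have h1 := ((hFdd (t, θ)).comp_hasDerivAt t (line1 t θ)).clm_apply
      (hasDerivAt_const t ((0 : ℝ), (1 : ℝ)))
    simp only [map_zero, add_zero] at h1
    rw [hsymm, show u = fun p => fderiv ℝ F p (0, 1) from funext hu]
    exact h1
  have hu0 : ∀ p, u p ≠ 0 := fun p => by
    have := hcimm p.1 p.2
    rwa [hcu] at this
  have hun : ∀ p, ‖u p‖ ≠ 0 := fun p => norm_ne_zero_iff.2 (hu0 p)
  have hup : ∀ p, 0 < ‖u p‖ := fun p => norm_pos_iff.2 (hu0 p)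
  have hpi : (0 : ℝ) < 2 * π := by positivity
  have hN' : ∀ t, N t = Real.sqrt (∫ θ in (0:ℝ)..2 * π,
      (‖v (t, θ)‖ ^ 2 * ‖u (t, θ)‖ + A * (‖w (t, θ)‖ ^ 2 / ‖u (t, θ)‖))) := by
    intro t
    rw [hN t]
    congr 1
    apply intervalIntegral.integral_congr
    intro θ _
    have h1 := hun (t, θ)
    simp only [Ds, hcu, hcv, hvw, norm_smul, norm_inv, norm_norm]
    field_simp
  have hℓ' : ℓ = fun t => ∫ θ in (0:ℝ)..2 * π, ‖u (t, θ)‖ := by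
    funext t
    rw [hℓ t]
    simp only [hcu]
  have hdℓ : ∀ t, HasDerivAt ℓ
      (∫ θ in (0:ℝ)..2 * π, inner ℝ (u (t, θ)) (w (t, θ)) / ‖u (t, θ)‖) t := by
    intro t
    rw [hℓ']
    refine hasDerivAt_param_aux (fun p => ‖u p‖) (fun p => inner ℝ (u p) (w p) / ‖u p‖)
      (by fun_prop) ?_ ?_ _ _ t
    · exact (huc.inner hwc).div huc.norm hun
    · intro t θ
      exact hasDerivAt_norm_aux (fun s => u (s, θ)) _ t (huw t θ) (hu0 _)
  have hℓpos : ∀ t, 0 < ℓ t := by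
    intro t
    rw [hℓ']
    exact intervalIntegral.intervalIntegral_pos_of_pos
      (Continuous.intervalIntegrable (by fun_prop) _ _) (fun θ => hup (t, θ)) hpi
  have hsA : 0 < Real.sqrt A := Real.sqrt_pos.2 hA
  have hNnn : ∀ t, 0 ≤ N t := fun t => by rw [hN]; exact Real.sqrt_nonneg _
  have hbound : ∀ t, |deriv ℓ t| ≤ Real.sqrt (ℓ t) * (Real.sqrt A)⁻¹ * N t := by
    intro t
    have hg : Continuous fun θ => ‖u (t, θ)‖ := by fun_prop
    have hw1 : Continuous fun θ => ‖w (t, θ)‖ := by fun_prop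
    have hv1 : Continuous fun θ => ‖v (t, θ)‖ := by fun_prop
    have hq : Continuous fun θ => ‖w (t, θ)‖ ^ 2 / ‖u (t, θ)‖ :=
      (hw1.pow 2).div hg fun θ => hun _
    have h1 : |deriv ℓ t| ≤ ∫ θ in (0:ℝ)..2 * π, ‖w (t, θ)‖ := by
      rw [(hdℓ t).deriv, ← Real.norm_eq_abs]
      refine intervalIntegral.norm_integral_le_of_norm_le hpi.le
        (Filter.Eventually.of_forall fun θ _ => ?_) (hw1.intervalIntegrable _ _)
      rw [norm_div, norm_norm, div_le_iff₀ (hup _), mul_comm]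
      exact norm_inner_le_norm _ _
    have h2 := cs_aux (fun θ => ‖u (t, θ)‖) (fun θ => ‖w (t, θ)‖) hg hw1 (fun θ => hup _)
      0 (2 * π) hpi.le
    have h3 : A * (∫ θ in (0:ℝ)..2 * π, ‖w (t, θ)‖ ^ 2 / ‖u (t, θ)‖) ≤ N t ^ 2 := by
      rw [hN' t, Real.sq_sqrt, ← intervalIntegral.integral_const_mul]
      · apply intervalIntegral.integral_mono_on hpi.le
        · exact (continuous_const.mul hq).intervalIntegrable _ _
        · exact (((hv1.pow 2).mul hg).add (continuous_const.mul hq)).intervalIntegrable _ _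
        · intro θ _
          have : 0 ≤ ‖v (t, θ)‖ ^ 2 * ‖u (t, θ)‖ := by positivity
          linarith
      · apply intervalIntegral.integral_nonneg hpi.le
        intro θ _
        positivity
    have h4 : ℓ t = ∫ θ in (0:ℝ)..2 * π, ‖u (t, θ)‖ := by rw [hℓ']
    rw [← h4] at h2
    refine h1.trans (abs_le_of_sq_le_sq' ?_ ?_).2
    · rw [mul_pow, mul_pow, inv_pow, Real.sq_sqrt hA.le, Real.sq_sqrt (hℓpos t).le]
      refine h2.trans ?_
      rw [mul_comm, mul_assoc]
      refine mul_le_mul_of_nonneg_left ?_ (hℓpos t).le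
      rw [inv_mul_eq_div, le_div_iff₀ hA, mul_comm]
      exact h3
    · have := hNnn t
      positivity
  have hdsq : ∀ t, HasDerivAt (fun s => Real.sqrt (ℓ s)) (deriv ℓ t / (2 * Real.sqrt (ℓ t))) t :=
    fun t => ((hdℓ t).differentiableAt.hasDerivAt).sqrt (hℓpos t).ne'
  have hbound2 : ∀ t, |deriv (fun s => Real.sqrt (ℓ s)) t| ≤ (2 * Real.sqrt A)⁻¹ * N t := by
    intro t
    have h1 : 0 < Real.sqrt (ℓ t) := Real.sqrt_pos.2 (hℓpos t)
    rw [(hdsq t).deriv, abs_div, abs_of_pos (by positivity : 0 < 2 * Real.sqrt (ℓ t)),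
      div_le_iff₀ (by positivity)]
    refine (hbound t).trans (le_of_eq ?_)
    field_simp
  have hNc : Continuous N := by
    rw [show N = _ from funext hN']
    refine Real.continuous_sqrt.comp
      (intervalIntegral.continuous_parametric_intervalIntegral_of_continuous' ?_ _ _)
    have : Continuous fun p : ℝ × ℝ => ‖v p‖ ^ 2 * ‖u p‖ + A * (‖w p‖ ^ 2 / ‖u p‖) :=
      ((hvc.norm.pow 2).mul huc.norm).add
        (continuous_const.mul ((hwc.norm.pow 2).div huc.norm hun))
    exact this
  refine ⟨fun t => (le_abs_self _).trans (hbound t), fun t => (le_abs_self _).trans (hbound2 t), ?_⟩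
  rw [← intervalIntegral.integral_const_mul, ← Real.norm_eq_abs]
  have hdiff : Differentiable ℝ (fun s => Real.sqrt (ℓ s)) := fun t => (hdsq t).differentiableAt
  exact norm_sub_le_integral_of_norm_deriv_le_of_le (f := fun s => Real.sqrt (ℓ s)) zero_le_one
    hdiff.continuous.continuousOn hdiff.differentiableOn
    (Filter.Eventually.of_forall fun t _ => hbound2 t)
    ((continuous_const.mul hNc).intervalIntegrable _ _)
end
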